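/- Let b be a nonzero integer, R = Z[X]/(X^5 + 4*b^4*X - 1), θ the class of X in R, and let ξ_1 = θ and ξ_2 = θ^2 + 2*b*θ + 2*b^2, which are units of R. Then for all integers m and n, one has m^5 + 4*b^4*m*n^4 - n^5 = 1 if and only if there exist integers n_1, n_2 such that m - n*θ = ξ_1^{n_1} · ξ_2^{n_2} in R. -/

import Mathlib

open Polynomial

/-- The polynomial `X^5 + 4*b^4*X - 1` over `ℤ`, so that `AdjoinRoot (thuePoly b)` is the ring
`R = ℤ[X]/(X^5 + 4*b^4*X - 1)`. -/
noncomputable def thuePoly (b : ℤ) : ℤ[X] := X ^ 5 + C (4 * b ^ 4) * X - 1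

/-- Derivatives at the nodes of a quintic `X^5 + cX - 1` with distinct roots. -/
lemma prod_erase_sub_eq {c : ℂ} {v : Fin 5 → ℂ} (hv : Function.Injective v)
    (hroot : ∀ i, v i ^ 5 + c * v i - 1 = 0) (i : Fin 5) :
    ∏ j ∈ Finset.univ.erase i, (v i - v j) = 5 * v i ^ 4 + c := by
  have hnod : (X ^ 5 + C c * X - 1 : ℂ[X]) = Lagrange.nodal Finset.univ v := by
    have hdeg : (X ^ 5 + C c * X - 1 : ℂ[X]).degree = 5 := by compute_degree!
    have hmon : (X ^ 5 + C c * X - 1 : ℂ[X]).Monic := by monicity!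
    refine Polynomial.eq_of_degree_sub_lt_of_eval_index_eq Finset.univ (v := v) hv.injOn ?_ ?_
    · refine (degree_sub_lt_left ?_ hmon.ne_zero ?_).trans_eq ?_
      · rw [Lagrange.degree_nodal, hdeg]; rfl
      · rw [hmon.leadingCoeff, (Lagrange.nodal_monic).leadingCoeff]
      · rw [hdeg]; rfl
    · intro k hk
      rw [Lagrange.eval_nodal_at_node hk]
      simpa using hroot k
  have h := Lagrange.eval_nodal_derivative_eval_node_eq (v := v) (Finset.mem_univ i)
  rw [← hnod, Lagrange.eval_nodal] at h
  rw [← h]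
  simp only [derivative_sub, derivative_add, derivative_X_pow, derivative_C_mul, derivative_X,
    derivative_one, eval_sub, eval_add, eval_mul, eval_pow, eval_C, eval_X, eval_one, eval_zero]
  push_cast
  ring

/-- Euler's formula for the top coefficient of a quartic polynomial. -/
lemma top_coeff_eq_sum {c : ℂ} {v : Fin 5 → ℂ} (hv : Function.Injective v)
    (hroot : ∀ i, v i ^ 5 + c * v i - 1 = 0) (a₀ a₁ a₂ a₃ a₄ : ℂ) :
    a₄ = ∑ i, (a₀ + a₁ * v i + a₂ * v i ^ 2 + a₃ * v i ^ 3 + a₄ * v i ^ 4) /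
      (5 * v i ^ 4 + c) := by
  have hdeg : (C a₀ + C a₁ * X + C a₂ * X ^ 2 + C a₃ * X ^ 3 + C a₄ * X ^ 4 : ℂ[X]).degree
      < (Finset.univ : Finset (Fin 5)).card := by
    have : (C a₀ + C a₁ * X + C a₂ * X ^ 2 + C a₃ * X ^ 3 + C a₄ * X ^ 4 : ℂ[X]).degree ≤ 4 := by
      compute_degree
    exact this.trans_lt (by simp; norm_cast)
  have h := Lagrange.coeff_eq_sum (v := v) hv.injOn hdeg
  simp only [prod_erase_sub_eq hv hroot] at h
  simpa [coeff_X, coeff_C] using h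

/-- The coefficients of a small polynomial in a root of `X^5 + cX - 1` are bounded by its values. -/
lemma norm_coeff_le {c : ℂ} {v : Fin 5 → ℂ} (hv : Function.Injective v)
    (hroot : ∀ i, v i ^ 5 + c * v i - 1 = 0) (a : Fin 5 → ℂ) (j : Fin 4) :
    ‖a j.succ‖ ≤ ∑ i, ‖∑ k, a k * v i ^ (k : ℕ)‖ * ‖v i‖ ^ (3 - (j : ℕ)) /
      ‖5 * v i ^ 4 + c‖ := by
  have key : a j.succ = ∑ i, (∑ k, a k * v i ^ (k : ℕ)) * v i ^ (3 - (j : ℕ)) /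
      (5 * v i ^ 4 + c) := by
    have aux (a₀ a₁ a₂ a₃ a₄ : ℂ) (h₄ : a j.succ = a₄)
        (h : ∀ i, (∑ k, a k * v i ^ (k : ℕ)) * v i ^ (3 - (j : ℕ)) =
          a₀ + a₁ * v i + a₂ * v i ^ 2 + a₃ * v i ^ 3 + a₄ * v i ^ 4) :
        a j.succ = ∑ i, (∑ k, a k * v i ^ (k : ℕ)) * v i ^ (3 - (j : ℕ)) /
          (5 * v i ^ 4 + c) := by
      simp only [h, h₄]
      exact top_coeff_eq_sum hv hroot a₀ a₁ a₂ a₃ a₄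
    fin_cases j
    · refine aux (a 2) (a 3 - c * a 2) (a 4 - c * a 3) (a 0 - c * a 4) (a 1) rfl fun i ↦ ?_
      simp only [Fin.sum_univ_five]
      simp
      linear_combination (a 2 + a 3 * v i + a 4 * v i ^ 2) * hroot i
    · refine aux (a 3) (a 4 - c * a 3) (a 0 - c * a 4) (a 1) (a 2) rfl fun i ↦ ?_
      simp only [Fin.sum_univ_five]
      simp
      linear_combination (a 3 + a 4 * v i) * hroot i
    · refine aux (a 4) (a 0 - c * a 4) (a 1) (a 2) (a 3) rfl fun i ↦ ?_
      simp only [Fin.sum_univ_five]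
      simp
      linear_combination a 4 * hroot i
    · refine aux (a 0) (a 1) (a 2) (a 3) (a 4) rfl fun i ↦ ?_
      simp only [Fin.sum_univ_five]
      simp
  rw [key]
  refine (norm_sum_le _ _).trans (Finset.sum_le_sum fun i _ ↦ ?_)
  rw [norm_div, norm_mul, norm_pow]

/-- Evaluation of `ℤ[X]/(X^5 + 4b^4X - 1)` at a root of the quintic. -/
noncomputable def evalRoot {S : Type*} [CommRing S] (b : ℤ) (x : S)
    (hx : x ^ 5 + 4 * (b : S) ^ 4 * x - 1 = 0) : AdjoinRoot (thuePoly b) →+* S :=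
  AdjoinRoot.lift (Int.castRingHom S) x (by
    simp only [thuePoly, eval₂_sub, eval₂_add, eval₂_mul, eval₂_X_pow, eval₂_X, eval₂_C, eval₂_one]
    simpa using hx)

lemma thuePoly_monic (b : ℤ) : (thuePoly b).Monic := by
  unfold thuePoly; monicity!

lemma thuePoly_natDegree (b : ℤ) : (thuePoly b).natDegree = 5 := by
  unfold thuePoly; compute_degree!

@[simp] lemma evalRoot_root {S : Type*} [CommRing S] (b : ℤ) (x : S)
    (hx : x ^ 5 + 4 * (b : S) ^ 4 * x - 1 = 0) :
    evalRoot b x hx (AdjoinRoot.root _) = x := AdjoinRoot.lift_root _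

lemma exists_eq_sum_root (b : ℤ) (β : AdjoinRoot (thuePoly b)) :
    ∃ a : Fin 5 → ℤ, β = ∑ k, (a k : AdjoinRoot (thuePoly b)) *
      AdjoinRoot.root (thuePoly b) ^ (k : ℕ) := by
  obtain ⟨g, rfl⟩ := AdjoinRoot.mk_surjective β
  refine ⟨fun k ↦ (g %ₘ thuePoly b).coeff k, ?_⟩
  have h1 : AdjoinRoot.mk (thuePoly b) g = AdjoinRoot.mk (thuePoly b) (g %ₘ thuePoly b) := by
    rw [AdjoinRoot.mk_eq_mk]
    exact ⟨g /ₘ thuePoly b, by linear_combination -modByMonic_add_div g (thuePoly b)⟩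
  have h2 : (g %ₘ thuePoly b).natDegree < 5 := by
    have := natDegree_modByMonic_lt g (thuePoly_monic b) (fun h ↦ by
      have := thuePoly_natDegree b; rw [h] at this; simp at this)
    rwa [thuePoly_natDegree] at this
  rw [h1]
  conv_lhs => rw [as_sum_range_C_mul_X_pow' _ h2]
  rw [map_sum, Finset.sum_range]
  simp

lemma exists_eq_intCast_of_sum_lt {b : ℤ} {v : Fin 5 → ℂ} (hv : Function.Injective v)
    (hroot : ∀ i, v i ^ 5 + 4 * (b : ℂ) ^ 4 * v i - 1 = 0) (β : AdjoinRoot (thuePoly b))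
    (hβ : ∀ j : Fin 4, ∑ i, ‖evalRoot b (v i) (hroot i) β‖ * ‖v i‖ ^ (3 - (j : ℕ)) /
      ‖5 * v i ^ 4 + 4 * (b : ℂ) ^ 4‖ < 1) : ∃ n : ℤ, β = n := by
  obtain ⟨a, rfl⟩ := exists_eq_sum_root b β
  have hz (j : Fin 4) : a j.succ = 0 := by
    have h := (norm_coeff_le hv hroot (fun k ↦ (a k : ℂ)) j).trans_lt
      (by simpa [map_sum] using hβ j)
    rw [Complex.norm_intCast] at h
    exact Int.abs_lt_one_iff.mp (by exact_mod_cast h)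
  refine ⟨a 0, ?_⟩
  rw [Fin.sum_univ_succ]
  simp [hz]

/-- The real data of the factorization
`X^5 + cX - 1 = (X - t)(X^2 - pX + q)(X^2 - p'X + q')` over `ℝ`, where the first quadratic has its
roots in the right half plane and the second one in the left half plane. -/
structure QuinticFactors (c t p q p' q' : ℝ) : Prop where
  t_pos : 0 < t
  p_pos : 0 < p
  p'_neg : p' < 0
  disc : p ^ 2 < 4 * q
  disc' : p' ^ 2 < 4 * q'
  e₁ : t + p + p' = 0
  e₂ : q + q' + p * p' = t ^ 2
  e₃ : q * p' + q' * p = -t ^ 3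
  e₄ : q * q' = c + t ^ 4
  e₅ : t * (c + t ^ 4) = 1

lemma exists_quinticFactors {c : ℝ} (hc : 1 ≤ c) :
    ∃ t p q p' q', QuinticFactors c t p q p' q' := by
  obtain ⟨t, ⟨ht0, ht1⟩, ht⟩ : ∃ t ∈ Set.Icc (0 : ℝ) 1, t ^ 5 + c * t - 1 = 0 := by
    have hcont : ContinuousOn (fun t : ℝ ↦ t ^ 5 + c * t - 1) (Set.Icc 0 1) := by fun_prop
    exact intermediate_value_Icc zero_le_one hcont ⟨by norm_num, by norm_num; linarith⟩
  have htpos : 0 < t := ht0.lt_of_ne (by rintro rfl; norm_num at ht)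
  have hreal (x : ℝ) : x ^ 4 + t * x ^ 3 + t ^ 2 * x ^ 2 + t ^ 3 * x + (t ^ 4 + c) ≠ 0 := by
    have : x ^ 4 + t * x ^ 3 + t ^ 2 * x ^ 2 + t ^ 3 * x + t ^ 4 =
        (x ^ 2 + t * x / 2) ^ 2 + t ^ 2 * x ^ 2 / 2 + t ^ 2 * (x + 2 * t) ^ 2 / 4 := by ring
    nlinarith [sq_nonneg (x ^ 2 + t * x / 2), sq_nonneg (t * x), sq_nonneg (t * (x + 2 * t))]
  obtain ⟨w, hw⟩ : ∃ w : ℂ,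
      w ^ 4 + t * w ^ 3 + (t : ℂ) ^ 2 * w ^ 2 + (t : ℂ) ^ 3 * w + (t ^ 4 + c) = 0 := by
    have hdeg : (X ^ 4 + C (t : ℂ) * X ^ 3 + C ((t : ℂ) ^ 2) * X ^ 2 + C ((t : ℂ) ^ 3) * X +
        C ((t : ℂ) ^ 4 + c)).degree = 4 := by compute_degree!
    obtain ⟨w, hw⟩ := IsAlgClosed.exists_root _ (by rw [hdeg]; norm_num)
    exact ⟨w, by simpa using hw⟩
  have him : w.im ≠ 0 := fun h ↦ by
    have hre : w = (w.re : ℂ) := Complex.ext rfl (by simp [h])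
    rw [hre] at hw
    exact hreal w.re (by exact_mod_cast hw)
  set p := 2 * w.re with hp
  set q := w.re ^ 2 + w.im ^ 2 with hq
  set q' := t ^ 2 - q + p * (p + t) with hq'
  have hquad : w ^ 2 - p * w + q = 0 := by
    apply Complex.ext <;> simp [hp, hq, pow_two] <;> ring
  have hrem : ((t ^ 3 + q' * p + q * (-t - p) : ℝ) : ℂ) * w + ((t ^ 4 + c - q * q' : ℝ) : ℂ) = 0 := by
    push_cast [hq']
    linear_combination hw - (w ^ 2 + (t + p) * w + (t ^ 2 - q + p * (p + t))) * hquad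
  have h3 : t ^ 3 + q' * p + q * (-t - p) = 0 := by
    have := congrArg Complex.im hrem
    rw [Complex.add_im, Complex.im_ofReal_mul, Complex.ofReal_im, add_zero, Complex.zero_im] at this
    exact (mul_eq_zero.mp this).resolve_right him
  have h4 : t ^ 4 + c - q * q' = 0 := by
    rw [h3, Complex.ofReal_zero, zero_mul, zero_add] at hrem
    exact_mod_cast hrem
  have hqpos : 0 < q := by positivity
  have hdisc : p ^ 2 < 4 * q := by rw [hp, hq]; nlinarith [sq_pos_of_ne_zero him]
  have hq'pos : 0 < q' := by
    by_contra! h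
    nlinarith [mul_nonneg hqpos.le (neg_nonneg.mpr h), pow_pos htpos 4]
  have hdisc' : (-t - p) ^ 2 < 4 * q' := by
    by_contra! h
    set s := √((-t - p) ^ 2 - 4 * q')
    have hs : s ^ 2 = (-t - p) ^ 2 - 4 * q' := Real.sq_sqrt (by linarith)
    refine hreal (((-t - p) + s) / 2) ?_
    set x := ((-t - p) + s) / 2 with hx
    have hx0 : x ^ 2 - (-t - p) * x + q' = 0 := by rw [hx]; linear_combination hs / 4
    linear_combination (x ^ 2 - p * x + q) * hx0 + h3 * x + h4
  have h2 : q + q' + p * (-t - p) = t ^ 2 := by rw [hq']; ring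
  have h5 : t * (c + t ^ 4) = 1 := by linear_combination ht
  have hpp : p * (-t - p) < 0 := by
    have h1 : t ^ 2 ≤ 1 := by nlinarith
    have h6 : 4 * (q * q') ≤ (q + q') ^ 2 := by nlinarith [sq_nonneg (q - q')]
    have : 1 < q + q' := by nlinarith [pow_pos htpos 4]
    nlinarith
  rcases lt_trichotomy p 0 with hneg | h0 | hpos
  · exact ⟨t, -t - p, q', p, q, htpos, by nlinarith, hneg, hdisc', hdisc, by ring,
      by linear_combination h2, by linear_combination h3, by linear_combination -h4, h5⟩
  · rw [h0] at hpp; simp at hpp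
  · exact ⟨t, p, q, -t - p, q', htpos, hpos, by nlinarith, hdisc, hdisc', by ring,
      by linear_combination h2, by linear_combination h3, by linear_combination -h4, h5⟩

/-- The root in the upper half plane of `X^2 - pX + q` when `p^2 < 4q`. -/
noncomputable def upperRoot (p q : ℝ) : ℂ := ⟨p / 2, √(q - p ^ 2 / 4)⟩

section upperRoot

variable {p q : ℝ}

lemma upperRoot_im_pos (h : p ^ 2 < 4 * q) : 0 < (upperRoot p q).im :=
  Real.sqrt_pos.mpr (by linarith)

lemma upperRoot_sq (h : p ^ 2 < 4 * q) : upperRoot p q ^ 2 = p * upperRoot p q - q := by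
  have hs : √(q - p ^ 2 / 4) ^ 2 = q - p ^ 2 / 4 := Real.sq_sqrt (by linarith)
  apply Complex.ext
  · simp [upperRoot, pow_two] at hs ⊢
    linear_combination -hs
  · simp [upperRoot, pow_two]
    ring

lemma normSq_add_mul_upperRoot (h : p ^ 2 < 4 * q) (x y : ℝ) :
    ‖(x : ℂ) + y * upperRoot p q‖ ^ 2 = x ^ 2 + x * y * p + y ^ 2 * q := by
  have hs : √(q - p ^ 2 / 4) ^ 2 = q - p ^ 2 / 4 := Real.sq_sqrt (by linarith)
  rw [Complex.sq_norm, Complex.normSq_apply]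
  simp [upperRoot]
  linear_combination y ^ 2 * hs

lemma norm_upperRoot (h : p ^ 2 < 4 * q) : ‖upperRoot p q‖ ^ 2 = q := by
  simpa using normSq_add_mul_upperRoot h 0 1

lemma upperRoot_eq_zero {c t p' q' : ℝ} (h : p ^ 2 < 4 * q) (e₁ : t + p + p' = 0)
    (e₂ : q + q' + p * p' = t ^ 2) (e₃ : q * p' + q' * p = -t ^ 3) (e₄ : q * q' = c + t ^ 4)
    (e₅ : t * (c + t ^ 4) = 1) : upperRoot p q ^ 5 + c * upperRoot p q - 1 = 0 := by
  have h := upperRoot_sq h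
  have e₁ : (p' : ℂ) = -t - p := by exact_mod_cast (by linear_combination e₁ : p' = -t - p)
  have e₂ : (q : ℂ) + q' + p * p' = t ^ 2 := by exact_mod_cast e₂
  have e₃ : (q : ℂ) * p' + q' * p = - t ^ 3 := by exact_mod_cast e₃
  have e₄ : (q : ℂ) * q' = c + t ^ 4 := by exact_mod_cast e₄
  have e₅ : (t : ℂ) * (c + t ^ 4) = 1 := by exact_mod_cast e₅
  set w := upperRoot p q
  rw [e₁] at e₂ e₃
  linear_combination (w - t) * (w ^ 2 + (t + p) * w + q') * h + (t * w ^ 2 - w ^ 3) * e₂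
    + (w ^ 2 - t * w) * e₃ - (w - t) * e₄ + e₅

end upperRoot

namespace QuinticFactors

variable {c t p q p' q' : ℝ}

lemma root_eq_zero (H : QuinticFactors c t p q p' q') : t ^ 5 + c * t - 1 = 0 := by
  linear_combination H.e₅

lemma upperRoot_eq_zero (H : QuinticFactors c t p q p' q') :
    upperRoot p q ^ 5 + c * upperRoot p q - 1 = 0 :=
  _root_.upperRoot_eq_zero H.disc H.e₁ H.e₂ H.e₃ H.e₄ H.e₅

lemma upperRoot'_eq_zero (H : QuinticFactors c t p q p' q') :
    upperRoot p' q' ^ 5 + c * upperRoot p' q' - 1 = 0 :=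
  _root_.upperRoot_eq_zero (t := t) (p' := p) (q' := q) H.disc'
    (by linear_combination H.e₁) (by linear_combination H.e₂)
    (by linear_combination H.e₃) (by linear_combination H.e₄) H.e₅

/-- The five complex roots. -/
noncomputable def roots (_ : QuinticFactors c t p q p' q') : Fin 5 → ℂ :=
  ![t, upperRoot p q, (starRingEnd ℂ) (upperRoot p q), upperRoot p' q',
    (starRingEnd ℂ) (upperRoot p' q')]

lemma roots_injective (H : QuinticFactors c t p q p' q') : Function.Injective H.roots := by
  have h1 := upperRoot_im_pos H.disc
  have h2 := upperRoot_im_pos H.disc'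
  have h3 : (upperRoot p q).re = p / 2 := rfl
  have h4 : (upperRoot p' q').re = p' / 2 := rfl
  have h5 := H.p_pos
  have h6 := H.p'_neg
  intro i j hij
  have hre := congrArg Complex.re hij
  have him := congrArg Complex.im hij
  fin_cases i <;> fin_cases j <;> first | rfl | (exfalso; simp [roots] at hre him; linarith)

lemma roots_eq_zero (H : QuinticFactors c t p q p' q') (i : Fin 5) :
    H.roots i ^ 5 + c * H.roots i - 1 = 0 := by
  have h0 : (t : ℂ) ^ 5 + c * t - 1 = 0 := by exact_mod_cast H.root_eq_zero
  have h1 := H.upperRoot_eq_zero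
  have h2 := H.upperRoot'_eq_zero
  fin_cases i
  · exact h0
  · exact h1
  · simpa [roots] using congrArg (starRingEnd ℂ) h1
  · exact h2
  · simpa [roots] using congrArg (starRingEnd ℂ) h2

end QuinticFactors

lemma evalRoot_conj {b : ℤ} {x : ℂ} (hx : x ^ 5 + 4 * (b : ℂ) ^ 4 * x - 1 = 0)
    (hx' : (starRingEnd ℂ) x ^ 5 + 4 * (b : ℂ) ^ 4 * (starRingEnd ℂ) x - 1 = 0)
    (β : AdjoinRoot (thuePoly b)) :
    evalRoot b _ hx' β = (starRingEnd ℂ) (evalRoot b x hx β) := by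
  obtain ⟨a, rfl⟩ := exists_eq_sum_root b β
  simp

/-- The weighted sum of absolute values controlling the coefficient of `θ^(4-k)`. -/
noncomputable def weight (c t p q p' q' : ℝ) (k : ℕ) (x y z : ℝ) : ℝ :=
  x * t ^ k / (5 * t ^ 4 + c) +
    2 * (y * ‖upperRoot p q‖ ^ k / ‖5 * upperRoot p q ^ 4 + c‖) +
    2 * (z * ‖upperRoot p' q'‖ ^ k / ‖5 * upperRoot p' q' ^ 4 + c‖)

lemma exists_eq_intCast {b : ℤ} {t p q p' q' : ℝ}
    (H : QuinticFactors (4 * (b : ℝ) ^ 4) t p q p' q')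
    (h₀ : (t : ℂ) ^ 5 + 4 * (b : ℂ) ^ 4 * t - 1 = 0)
    (h₁ : upperRoot p q ^ 5 + 4 * (b : ℂ) ^ 4 * upperRoot p q - 1 = 0)
    (h₂ : upperRoot p' q' ^ 5 + 4 * (b : ℂ) ^ 4 * upperRoot p' q' - 1 = 0)
    (β : AdjoinRoot (thuePoly b))
    (hw0 : weight (4 * b ^ 4) t p q p' q' 0 ‖evalRoot b _ h₀ β‖ ‖evalRoot b _ h₁ β‖
      ‖evalRoot b _ h₂ β‖ < 1)
    (hw3 : weight (4 * b ^ 4) t p q p' q' 3 ‖evalRoot b _ h₀ β‖ ‖evalRoot b _ h₁ β‖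
      ‖evalRoot b _ h₂ β‖ < 1) : ∃ n : ℤ, β = n := by
  have hroot := H.roots_eq_zero
  push_cast at hroot
  refine exists_eq_intCast_of_sum_lt H.roots_injective hroot β fun j ↦ ?_
  have hconv (k : Fin 4) (A x : ℝ) (hA : 0 ≤ A) (hx : 0 ≤ x) :
      A * x ^ (3 - (k : ℕ)) ≤ (1 - (k : ℝ) / 3) * (A * x ^ 3) + (k : ℝ) / 3 * (A * x ^ 0) := by
    suffices h : x ^ (3 - (k : ℕ)) ≤ (1 - (k : ℝ) / 3) * x ^ 3 + (k : ℝ) / 3 by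
      nlinarith [mul_le_mul_of_nonneg_left h hA]
    fin_cases k <;> norm_num <;> nlinarith [mul_nonneg hx (sq_nonneg (x - 1)), sq_nonneg (x - 1)]
  have hsum (k : ℕ) : ∑ i, ‖evalRoot b (H.roots i) (hroot i) β‖ * ‖H.roots i‖ ^ k /
      ‖5 * H.roots i ^ 4 + 4 * (b : ℂ) ^ 4‖ = weight (4 * b ^ 4) t p q p' q' k
        ‖evalRoot b _ h₀ β‖ ‖evalRoot b _ h₁ β‖ ‖evalRoot b _ h₂ β‖ := by
    have hc₁ : ‖evalRoot b (H.roots 2) (hroot 2) β‖ = ‖evalRoot b _ h₁ β‖ :=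
      (congrArg norm (evalRoot_conj h₁ (hroot 2) β)).trans (RCLike.norm_conj _)
    have hc₂ : ‖evalRoot b (H.roots 4) (hroot 4) β‖ = ‖evalRoot b _ h₂ β‖ :=
      (congrArg norm (evalRoot_conj h₂ (hroot 4) β)).trans (RCLike.norm_conj _)
    have hd (x : ℂ) : ‖5 * (starRingEnd ℂ) x ^ 4 + 4 * (b : ℂ) ^ 4‖ =
        ‖5 * x ^ 4 + 4 * (b : ℂ) ^ 4‖ := by
      rw [← RCLike.norm_conj]; simp [map_ofNat]
    have ht : ‖5 * (t : ℂ) ^ 4 + 4 * (b : ℂ) ^ 4‖ = 5 * t ^ 4 + 4 * b ^ 4 := by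
      rw [show 5 * (t : ℂ) ^ 4 + 4 * (b : ℂ) ^ 4 = ((5 * t ^ 4 + 4 * b ^ 4 : ℝ) : ℂ) by push_cast; rfl,
        Complex.norm_real, Real.norm_of_nonneg (by positivity)]
    have ht' : ‖(t : ℂ)‖ = t := by rw [Complex.norm_real, Real.norm_of_nonneg H.t_pos.le]
    rw [Fin.sum_univ_five, hc₁, hc₂, weight]
    simp [QuinticFactors.roots, hd, ht, ht', -Complex.norm_real]
    ring
  have hle : ∑ i, ‖evalRoot b (H.roots i) (hroot i) β‖ * ‖H.roots i‖ ^ (3 - (j : ℕ)) /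
      ‖5 * H.roots i ^ 4 + 4 * (b : ℂ) ^ 4‖ ≤
      (1 - (j : ℝ) / 3) * (∑ i, ‖evalRoot b (H.roots i) (hroot i) β‖ * ‖H.roots i‖ ^ 3 /
      ‖5 * H.roots i ^ 4 + 4 * (b : ℂ) ^ 4‖) + (j : ℝ) / 3 *
      (∑ i, ‖evalRoot b (H.roots i) (hroot i) β‖ * ‖H.roots i‖ ^ 0 /
      ‖5 * H.roots i ^ 4 + 4 * (b : ℂ) ^ 4‖) := by
    rw [Finset.mul_sum, Finset.mul_sum, ← Finset.sum_add_distrib]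
    refine Finset.sum_le_sum fun i _ ↦ ?_
    have := hconv j (‖evalRoot b (H.roots i) (hroot i) β‖ / ‖5 * H.roots i ^ 4 + 4 * (b : ℂ) ^ 4‖)
      ‖H.roots i‖ (by positivity) (norm_nonneg _)
    simpa only [div_mul_eq_mul_div] using this
  refine hle.trans_lt ?_
  rw [hsum, hsum]
  have hj : (j : ℝ) ≤ 3 := by exact_mod_cast Nat.lt_succ_iff.mp j.isLt
  have hj0 : (0 : ℝ) ≤ j := Nat.cast_nonneg _
  rcases hj0.eq_or_lt with h | h
  · rw [← h]; linarith
  · nlinarith [mul_pos h (sub_pos.mpr hw0), mul_nonneg (sub_nonneg.mpr hj) (sub_pos.mpr hw3).le]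

/-- Numerical estimates for the absolute values `W`, `Z` of the complex roots of
`X^5 + 4X - ε`, of its derivative (`dw`, `dz`) and of `X^2 - 2X + 2` (`hw`, `hz`) at them. -/
structure RootBounds (W Z dw dz hw hz : ℝ) : Prop where
  le_W : 1.37 ≤ W
  W_le : W ≤ 1.4143
  le_Z : 1.41 ≤ Z
  Z_le : Z ≤ 1.459
  le_dw : 13.77 ≤ dw
  le_dz : 16 ≤ dz
  W_cube : W ^ 3 ≤ 0.1883 * dw
  Z_cube : Z ^ 3 ≤ 0.1785 * dz
  hw_le : hw ≤ 0.137
  hz_le : hz ≤ 5.92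
  hz_Z : hz * (Z ^ 3) ^ 2 ≤ (0.426 * dz) ^ 2


lemma le_of_sq_le {x y : ℝ} (h : x ^ 2 ≤ y ^ 2) (hy : 0 ≤ y) : x ≤ y :=
  (le_abs_self x).trans (abs_le_of_sq_le_sq h hy)

lemma factor_bounds_small {P Q Q' s : ℝ} (hs : 0 < s) (hs' : s ≤ 1 / 128) (hP : 0 < P)
    (hdisc : P ^ 2 < 4 * Q) (e₂ : Q + Q' = P ^ 2 + P * s + s ^ 2)
    (e₃ : P * (Q' - Q) = s * (Q - s ^ 2)) (e₄ : Q * Q' = 4 + s ^ 4) :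
    1.99 ≤ P ∧ P ≤ 2.0021 ∧ 1.992 ≤ Q ∧ Q ≤ 2.0001 ∧ 2 ≤ Q' ∧ Q' ≤ 2.0081 := by
  have hs4 : s ^ 4 ≤ 1e-8 := (pow_le_pow_left₀ hs.le hs' 4).trans (by norm_num)
  have hs40 : 0 < s ^ 4 := by positivity
  have hs2 : s ^ 2 ≤ 0.0001 := (pow_le_pow_left₀ hs.le hs' 2).trans (by norm_num)
  have hs20 : 0 < s ^ 2 := by positivity
  have hQ : 0 < Q := by linarith [sq_nonneg P]
  have hQ' : 0 < Q' := by
    by_contra! h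
    linarith [mul_nonneg hQ.le (neg_nonneg.mpr h)]
  have hS : 4 ≤ Q + Q' := by
    refine le_of_sq_le ?_ (by positivity)
    linarith [sq_nonneg (Q - Q'), show (Q + Q') ^ 2 = (Q - Q') ^ 2 + 4 * (Q * Q') by ring]
  have hP0 : 1.99 ≤ P := by
    by_contra! h
    have h1 : P ^ 2 ≤ 1.99 ^ 2 := pow_le_pow_left₀ hP.le h.le 2
    have h2 : P * s ≤ 1.99 * (1 / 128) := mul_le_mul h.le hs' hs.le (by norm_num)
    norm_num at h1 h2
    linarith
  have hQ1 : 0.99 ≤ Q := by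
    have h1 : 1.99 ^ 2 ≤ P ^ 2 := pow_le_pow_left₀ (by norm_num) hP0 2
    norm_num at h1
    linarith
  have hQQ : Q ≤ Q' := by
    have : 0 < P * (Q' - Q) := by rw [e₃]; exact mul_pos hs (by linarith)
    linarith [pos_of_mul_pos_right this hP.le]
  have hQ2 : Q ≤ 2.0001 := by
    refine le_of_sq_le ?_ (by norm_num)
    linarith [mul_le_mul_of_nonneg_left hQQ hQ.le, sq Q]
  have hQ2' : 2 ≤ Q' := by linarith
  have hδ : Q' - Q ≤ 0.00799 := by
    have h1 : P * (Q' - Q) ≤ 1 / 128 * 2.0001 := by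
      rw [e₃]; exact mul_le_mul hs' (by linarith) (by linarith) (by norm_num)
    have h2 : 1.99 * (Q' - Q) ≤ P * (Q' - Q) := mul_le_mul_of_nonneg_right hP0 (by linarith)
    linarith
  refine ⟨hP0, ?_, by linarith, hQ2, hQ2', by linarith⟩
  by_contra! h
  have h1 : 2.0021 ^ 2 ≤ P ^ 2 := pow_le_pow_left₀ (by norm_num) h.le 2
  have h2 : 0 < P * s := mul_pos hP hs
  norm_num at h1
  linarith

lemma rootBounds_small {P Q Q' s ε W Z dw dz hw hz g : ℝ} (hs : 0 < s) (hs' : s ≤ 1 / 128)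
    (hε : ε = s * (4 + s ^ 4)) (hP : 0 < P) (hdisc : P ^ 2 < 4 * Q)
    (e₂ : Q + Q' = P ^ 2 + P * s + s ^ 2) (e₃ : P * (Q' - Q) = s * (Q - s ^ 2))
    (e₄ : Q * Q' = 4 + s ^ 4)
    (hW : 0 ≤ W) (hZ : 0 ≤ Z) (hdw : 0 ≤ dw) (hdz : 0 ≤ dz) (hhw : 0 ≤ hw)
    (hg : 0 ≤ g) (eW : W ^ 2 = Q) (eZ : Z ^ 2 = Q')
    (edw : dw ^ 2 * Q = 256 * Q - 80 * P * ε + 25 * ε ^ 2)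
    (edz : dz ^ 2 * Q' = 256 * Q' + 80 * (P + s) * ε + 25 * ε ^ 2)
    (ehz : hz ^ 2 = Q' ^ 2 + 4 + 2 * Q' * (P + s) + 2 * (P + s) ^ 2 + 4 * (P + s))
    (eg : g ^ 2 = Q ^ 2 + 4 + 2 * Q * P + 2 * P ^ 2 + 4 * P) (ehw : hw * g * W = ε) :
    RootBounds W Z dw dz hw hz := by
  obtain ⟨hP0, hP1, hQ0, hQ1, hQ0', hQ1'⟩ := factor_bounds_small hs hs' hP hdisc e₂ e₃ e₄
  have hs4 : s ^ 4 ≤ 1e-8 := (pow_le_pow_left₀ hs.le hs' 4).trans (by norm_num)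
  have hε0 : 0 < ε := by rw [hε]; positivity
  have hε1 : ε ≤ 0.0317 := by
    have : s * (4 + s ^ 4) ≤ 1 / 128 * (4 + 1e-8) := by gcongr
    norm_num at this
    linarith
  have hQ : 0 < Q := by linarith
  have hQ' : 0 < Q' := by linarith
  have hPs : P + s ≤ 2.01 := by linarith
  have hPs0 : 0 < P + s := by linarith
  clear hε hs4 hdisc e₂ e₃ e₄
  have hW0 : 1.4113 ≤ W := le_of_sq_le (by norm_num; linarith) hW
  have hW1 : W ≤ 1.41426 := le_of_sq_le (by norm_num; linarith) (by norm_num)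
  have hZ0 : 1.414 ≤ Z := le_of_sq_le (by norm_num; linarith) hZ
  have hZ1 : Z ≤ 1.4171 := le_of_sq_le (by norm_num; linarith) (by norm_num)
  have hdw0 : 15.91 ≤ dw := by
    have h1 : P * ε ≤ 2.0021 * 0.0317 := mul_le_mul hP1 hε1 hε0.le (by norm_num)
    have h2 : 253.2 * Q ≤ dw ^ 2 * Q := by rw [edw]; norm_num at h1; linarith [sq_nonneg ε]
    have h3 := le_of_mul_le_mul_right h2 hQ
    exact le_of_sq_le (by norm_num; linarith) hdw
  have hdz0 : 16 ≤ dz := by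
    have h2 : 256 * Q' ≤ dz ^ 2 * Q' := by rw [edz]; linarith [mul_pos hPs0 hε0, sq_nonneg ε]
    have h3 := le_of_mul_le_mul_right h2 hQ'
    exact le_of_sq_le (by norm_num; linarith) hdz
  have hW3 : W ^ 3 ≤ 1.41426 ^ 3 := pow_le_pow_left₀ hW hW1 3
  have hZ3 : Z ^ 3 ≤ 1.4171 ^ 3 := pow_le_pow_left₀ hZ hZ1 3
  have hhz1 : hz ≤ 5.69 := by
    have h1 : Q' ^ 2 ≤ 2.0081 ^ 2 := pow_le_pow_left₀ hQ'.le hQ1' 2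
    have h2 : (P + s) ^ 2 ≤ 2.01 ^ 2 := pow_le_pow_left₀ hPs0.le hPs 2
    have h3 : Q' * (P + s) ≤ 2.0081 * 2.01 := mul_le_mul hQ1' hPs hPs0.le (by norm_num)
    norm_num at h1 h2 h3
    refine le_of_sq_le ?_ (by norm_num)
    rw [ehz]; norm_num; linarith
  have hg0 : 2 ≤ g := by
    refine le_of_sq_le ?_ hg
    rw [eg]; linarith [mul_pos hQ hP, sq_nonneg Q, sq_nonneg P]
  refine ⟨by linarith, by linarith, by linarith, by linarith, by linarith, by linarith,
    by norm_num at hW3; linarith, by norm_num at hZ3; linarith, ?_, by linarith, ?_⟩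
  · have : 2 * 1.4113 ≤ g * W := mul_le_mul hg0 hW0 (by norm_num) hg
    have h2 := mul_le_mul_of_nonneg_left this hhw
    norm_num at h2
    linarith
  · calc hz * (Z ^ 3) ^ 2 ≤ 5.69 * (1.4171 ^ 3) ^ 2 := by gcongr
      _ ≤ (0.426 * 16) ^ 2 := by norm_num
      _ ≤ _ := by gcongr

lemma factor_bounds_one {P Q Q' s : ℝ} (hs : 0 < s)
    (hε : s * (4 + s ^ 4) = 1) (hP : 0 < P) (hdisc : P ^ 2 < 4 * Q)
    (e₂ : Q + Q' = P ^ 2 + P * s + s ^ 2) (e₃ : P * (Q' - Q) = s * (Q - s ^ 2))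
    (e₄ : Q * Q' = 4 + s ^ 4) :
    0.2497 ≤ s ∧ s ≤ 0.2498 ∧ 1.86 ≤ P ∧ P ≤ 1.8662 ∧ 1.8785 ≤ Q ∧ Q ≤ 1.8844 ∧
      2.1218 ≤ Q' ∧ Q' ≤ 2.1277 := by
  have hs40 : 0 < s ^ 4 := by positivity
  have hs1 : s ≤ 0.25 := by linarith [mul_pos hs hs40]
  have hs41 : s ^ 4 ≤ 0.25 ^ 4 := pow_le_pow_left₀ hs.le hs1 4
  have hs0 : 0.2497 ≤ s := by
    have := mul_le_mul_of_nonneg_left hs41 hs.le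
    norm_num at this
    linarith
  have hs42 : 0.2497 ^ 4 ≤ s ^ 4 := pow_le_pow_left₀ (by norm_num) hs0 4
  have hs2 : s ≤ 0.2498 := by
    have := mul_le_mul_of_nonneg_left hs42 hs.le
    norm_num at this
    linarith
  have hs3 : 0.2497 ^ 2 ≤ s ^ 2 := pow_le_pow_left₀ (by norm_num) hs0 2
  have hs4 : s ^ 2 ≤ 0.2498 ^ 2 := pow_le_pow_left₀ hs.le hs2 2
  norm_num at hs41 hs42 hs3 hs4
  have hQ : 0 < Q := by linarith [sq_nonneg P]
  have hQ' : 0 < Q' := by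
    by_contra! h
    linarith [mul_nonneg hQ.le (neg_nonneg.mpr h)]
  have hsq : (Q + Q') ^ 2 = (Q' - Q) ^ 2 + 4 * (Q * Q') := by ring
  have hS : 4.0019 ≤ Q + Q' := by
    refine le_of_sq_le ?_ (by positivity)
    norm_num
    linarith [sq_nonneg (Q' - Q)]
  have hP0 : 1.86 ≤ P := by
    by_contra! h
    have h1 : P ^ 2 ≤ 1.86 ^ 2 := pow_le_pow_left₀ hP.le h.le 2
    have h2 : P * s ≤ 1.86 * 0.2498 := mul_le_mul h.le hs2 hs.le (by norm_num)
    norm_num at h1 h2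
    linarith
  have hQ1 : 0.86 ≤ Q := by
    have h1 : 1.86 ^ 2 ≤ P ^ 2 := pow_le_pow_left₀ (by norm_num) hP0 2
    norm_num at h1
    linarith
  have hQQ : Q ≤ Q' := by
    have : 0 < P * (Q' - Q) := by rw [e₃]; exact mul_pos hs (by linarith)
    linarith [pos_of_mul_pos_right this hP.le]
  have hQ2 : Q ≤ 2.001 := by
    refine le_of_sq_le ?_ (by norm_num)
    norm_num
    linarith [mul_le_mul_of_nonneg_left hQQ hQ.le, sq Q]
  have hδ : Q' - Q ≤ 0.2604 := by
    have h1 : P * (Q' - Q) ≤ 0.2498 * (2.001 - 0.0623) := by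
      rw [e₃]; exact mul_le_mul hs2 (by linarith) (by linarith) (by norm_num)
    have h2 : 1.86 * (Q' - Q) ≤ P * (Q' - Q) := mul_le_mul_of_nonneg_right hP0 (by linarith)
    linarith
  have hS1 : Q + Q' ≤ 4.01046 := by
    refine le_of_sq_le ?_ (by norm_num)
    have := pow_le_pow_left₀ (by linarith) hδ 2
    norm_num at this ⊢
    linarith
  have hP1 : P ≤ 1.8662 := by
    by_contra! h
    have h1 : 1.8662 ^ 2 ≤ P ^ 2 := pow_le_pow_left₀ (by norm_num) h.le 2
    have h2 : 1.8662 * 0.2497 ≤ P * s := mul_le_mul h.le hs0 (by norm_num) hP.le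
    norm_num at h1 h2
    linarith
  have hQ3 : 1.8707 ≤ Q := by linarith
  have hup {δ : ℝ} (h1 : P * (Q' - Q) ≤ 1.86 * δ) : Q' - Q ≤ δ := by
    have h2 : 1.86 * (Q' - Q) ≤ P * (Q' - Q) := mul_le_mul_of_nonneg_right hP0 (by linarith)
    linarith
  have hδ0 : 0.2418 ≤ Q' - Q := by
    have h1 : 0.2497 * (1.8707 - 0.0625) ≤ P * (Q' - Q) := by
      rw [e₃]; exact mul_le_mul hs0 (by linarith) (by norm_num) hs.le
    have h2 : P * (Q' - Q) ≤ 1.8662 * (Q' - Q) := mul_le_mul_of_nonneg_right hP1 (by linarith)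
    linarith
  have hQ4 : Q ≤ 1.8844 := by linarith
  have hδ1 : Q' - Q ≤ 0.2448 := by
    apply hup
    have h1 : P * (Q' - Q) ≤ 0.2498 * (1.8844 - 0.0623) := by
      rw [e₃]; exact mul_le_mul hs2 (by linarith) (by linarith) (by norm_num)
    linarith
  exact ⟨hs0, hs2, hP0, hP1, by linarith, hQ4, by linarith, by linarith⟩

lemma rootBounds_one {P Q Q' s W Z dw dz hw hz g : ℝ} (hs : 0 < s)
    (hε : s * (4 + s ^ 4) = 1) (hP : 0 < P) (hdisc : P ^ 2 < 4 * Q)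
    (e₂ : Q + Q' = P ^ 2 + P * s + s ^ 2) (e₃ : P * (Q' - Q) = s * (Q - s ^ 2))
    (e₄ : Q * Q' = 4 + s ^ 4)
    (hW : 0 ≤ W) (hZ : 0 ≤ Z) (hdw : 0 ≤ dw) (hdz : 0 ≤ dz) (hhw : 0 ≤ hw)
    (hg : 0 ≤ g) (eW : W ^ 2 = Q) (eZ : Z ^ 2 = Q')
    (edw : dw ^ 2 * Q = 256 * Q - 80 * P + 25)
    (edz : dz ^ 2 * Q' = 256 * Q' + 80 * (P + s) + 25)
    (ehz : hz ^ 2 = Q' ^ 2 + 4 + 2 * Q' * (P + s) + 2 * (P + s) ^ 2 + 4 * (P + s))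
    (eg : g ^ 2 = Q ^ 2 + 4 + 2 * Q * P + 2 * P ^ 2 + 4 * P) (ehw : hw * g * W = 1) :
    RootBounds W Z dw dz hw hz := by
  obtain ⟨hs0, hs1, hP0, hP1, hQ0, hQ1, hQ0', hQ1'⟩ := factor_bounds_one hs hε hP hdisc e₂ e₃ e₄
  have hQ : 0 < Q := by linarith
  have hQ' : 0 < Q' := by linarith
  have hPs : P + s ≤ 2.116 := by linarith
  have hPs0 : 0 < P + s := by linarith
  clear hε hdisc e₂ e₃ e₄
  have hW0 : 1.3705 ≤ W := le_of_sq_le (by norm_num; linarith) hW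
  have hW1 : W ≤ 1.37275 := le_of_sq_le (by norm_num; linarith) (by norm_num)
  have hZ0 : 1.456 ≤ Z := le_of_sq_le (by norm_num; linarith) hZ
  have hZ1 : Z ≤ 1.4588 := le_of_sq_le (by norm_num; linarith) (by norm_num)
  have hdw0 : 13.77 ≤ dw := by
    have h2 : 13.77 ^ 2 * Q ≤ dw ^ 2 * Q := by rw [edw]; norm_num; linarith
    have h3 := le_of_mul_le_mul_right h2 hQ
    exact le_of_sq_le h3 (by assumption)
  have hdz0 : 18.6 ≤ dz := by
    have h2 : 18.6 ^ 2 * Q' ≤ dz ^ 2 * Q' := by rw [edz]; norm_num; linarith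
    have h3 := le_of_mul_le_mul_right h2 hQ'
    exact le_of_sq_le h3 (by assumption)
  have hW3 : W ^ 3 ≤ 1.37275 ^ 3 := pow_le_pow_left₀ hW hW1 3
  have hZ3 : Z ^ 3 ≤ 1.4588 ^ 3 := pow_le_pow_left₀ hZ hZ1 3
  have hhz1 : hz ≤ 5.92 := by
    have h1 : Q' ^ 2 ≤ 2.1277 ^ 2 := pow_le_pow_left₀ hQ'.le hQ1' 2
    have h2 : (P + s) ^ 2 ≤ 2.116 ^ 2 := pow_le_pow_left₀ hPs0.le hPs 2
    have h3 : Q' * (P + s) ≤ 2.1277 * 2.116 := mul_le_mul hQ1' hPs hPs0.le (by norm_num)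
    norm_num at h1 h2 h3
    refine le_of_sq_le ?_ (by norm_num)
    rw [ehz]; norm_num; linarith
  have hg0 : 5.37 ≤ g := by
    have h1 : 1.8785 ^ 2 ≤ Q ^ 2 := pow_le_pow_left₀ (by norm_num) hQ0 2
    have h2 : 1.86 ^ 2 ≤ P ^ 2 := pow_le_pow_left₀ (by norm_num) hP0 2
    have h3 : 1.8785 * 1.86 ≤ Q * P := mul_le_mul hQ0 hP0 (by norm_num) hQ.le
    norm_num at h1 h2 h3
    refine le_of_sq_le ?_ hg
    rw [eg]; norm_num; linarith
  refine ⟨by linarith, by linarith, by linarith, by linarith, by linarith, by linarith,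
    by norm_num at hW3; linarith, by norm_num at hZ3; linarith, ?_, by linarith, ?_⟩
  · have : 5.37 * 1.3705 ≤ g * W := mul_le_mul hg0 hW0 (by norm_num) hg
    have h2 := mul_le_mul_of_nonneg_left this hhw
    norm_num at h2
    linarith
  · calc hz * (Z ^ 3) ^ 2 ≤ 5.92 * (1.4588 ^ 3) ^ 2 := by gcongr
      _ ≤ (0.426 * 18.6) ^ 2 := by norm_num
      _ ≤ _ := by gcongr

lemma normSq_quadratic {p q : ℝ} (h : p ^ 2 < 4 * q) (B : ℝ) :
    ‖upperRoot p q ^ 2 + 2 * B * upperRoot p q + 2 * (B : ℂ) ^ 2‖ ^ 2 =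
      q ^ 2 + 4 * B ^ 4 + 2 * B * p * q + 2 * B ^ 2 * p ^ 2 + 4 * B ^ 3 * p := by
  have := normSq_add_mul_upperRoot h (2 * B ^ 2 - q) (p + 2 * B)
  rw [upperRoot_sq h]
  push_cast at this
  rw [show (p : ℂ) * upperRoot p q - q + 2 * B * upperRoot p q + 2 * (B : ℂ) ^ 2 =
    2 * (B : ℂ) ^ 2 - q + (p + 2 * B) * upperRoot p q by ring, this]
  ring

lemma normSq_deriv_mul {c p q : ℝ} (h : p ^ 2 < 4 * q)
    (hr : upperRoot p q ^ 5 + c * upperRoot p q - 1 = 0) :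
    ‖5 * upperRoot p q ^ 4 + c‖ ^ 2 * q = 25 - 20 * c * p + 16 * c ^ 2 * q := by
  have h2 := normSq_add_mul_upperRoot h 5 (-4 * c)
  have h3 := norm_upperRoot h
  have h4 : ‖5 * upperRoot p q ^ 4 + c‖ ^ 2 * ‖upperRoot p q‖ ^ 2 =
      25 - 20 * c * p + 16 * c ^ 2 * q := by
    rw [← mul_pow, ← norm_mul, show (5 * upperRoot p q ^ 4 + c) * upperRoot p q =
      ((5 : ℝ) : ℂ) + ((-4 * c : ℝ) : ℂ) * upperRoot p q by
      push_cast; linear_combination 5 * hr, h2]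
    ring
  rwa [h3] at h4

namespace QuinticFactors

variable {A t p q p' q' : ℝ}

lemma rootBounds (H : QuinticFactors (4 * A ^ 4) t p q p' q') (hA : A = 1 ∨ 2 ≤ A) :
    RootBounds (‖upperRoot p q‖ / A) (‖upperRoot p' q'‖ / A)
      (‖5 * upperRoot p q ^ 4 + (4 * A ^ 4 : ℝ)‖ / A ^ 4)
      (‖5 * upperRoot p' q' ^ 4 + (4 * A ^ 4 : ℝ)‖ / A ^ 4)
      (‖upperRoot p q ^ 2 - 2 * A * upperRoot p q + 2 * (A : ℂ) ^ 2‖ / A ^ 2)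
      (‖upperRoot p' q' ^ 2 - 2 * A * upperRoot p' q' + 2 * (A : ℂ) ^ 2‖ / A ^ 2) := by
  have hA0 : 0 < A := by rcases hA with h | h <;> linarith
  have ht := H.t_pos
  have hp' : p' = -t - p := by linear_combination H.e₁
  have hw := H.upperRoot_eq_zero
  have hz := H.upperRoot'_eq_zero
  have hdw := normSq_deriv_mul H.disc hw
  have hdz := normSq_deriv_mul H.disc' hz
  have hg := normSq_quadratic H.disc A
  have hh := normSq_quadratic H.disc' (-A)
  rw [show upperRoot p' q' ^ 2 + 2 * ((-A : ℝ) : ℂ) * upperRoot p' q' + 2 * ((-A : ℝ) : ℂ) ^ 2 =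
    upperRoot p' q' ^ 2 - 2 * A * upperRoot p' q' + 2 * (A : ℂ) ^ 2 by push_cast; ring] at hh
  have hprod : ‖upperRoot p q ^ 2 - 2 * A * upperRoot p q + 2 * (A : ℂ) ^ 2‖ *
      ‖upperRoot p q ^ 2 + 2 * A * upperRoot p q + 2 * (A : ℂ) ^ 2‖ * ‖upperRoot p q‖ = 1 := by
    rw [← norm_mul, ← norm_mul, ← norm_one (α := ℂ)]
    push_cast at hw
    exact congrArg norm (by linear_combination hw)
  have hW := norm_upperRoot H.disc
  have hZ := norm_upperRoot H.disc'
  have hA' : A ≠ 0 := hA0.ne'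
  have e₂ : q / A ^ 2 + q' / A ^ 2 = (p / A) ^ 2 + p / A * (t / A) + (t / A) ^ 2 := by
    field_simp; rw [hp'] at H; linear_combination H.e₂
  have e₃ : p / A * (q' / A ^ 2 - q / A ^ 2) = t / A * (q / A ^ 2 - (t / A) ^ 2) := by
    field_simp; rw [hp'] at H; linear_combination H.e₃
  have e₄ : q / A ^ 2 * (q' / A ^ 2) = 4 + (t / A) ^ 4 := by
    field_simp; linear_combination H.e₄
  have e₅ : t / A * (4 + (t / A) ^ 4) = 1 / A ^ 5 := by
    field_simp; linear_combination H.e₅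
  have hdisc : (p / A) ^ 2 < 4 * (q / A ^ 2) := by
    rw [div_pow, ← mul_div_assoc]; exact div_lt_div_of_pos_right H.disc (by positivity)
  have hs : 0 < t / A := by positivity
  have hP : 0 < p / A := div_pos H.p_pos hA0
  have eW : (‖upperRoot p q‖ / A) ^ 2 = q / A ^ 2 := by rw [div_pow, hW]
  have eZ : (‖upperRoot p' q'‖ / A) ^ 2 = q' / A ^ 2 := by rw [div_pow, hZ]
  have edw : (‖5 * upperRoot p q ^ 4 + (4 * A ^ 4 : ℝ)‖ / A ^ 4) ^ 2 * (q / A ^ 2) =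
      256 * (q / A ^ 2) - 80 * (p / A) * (1 / A ^ 5) + 25 * (1 / A ^ 5) ^ 2 := by
    field_simp; linear_combination hdw
  have edz : (‖5 * upperRoot p' q' ^ 4 + (4 * A ^ 4 : ℝ)‖ / A ^ 4) ^ 2 * (q' / A ^ 2) =
      256 * (q' / A ^ 2) + 80 * (p / A + t / A) * (1 / A ^ 5) + 25 * (1 / A ^ 5) ^ 2 := by
    field_simp; linear_combination hdz - 80 * A ^ 4 * hp'
  have ehz : (‖upperRoot p' q' ^ 2 - 2 * A * upperRoot p' q' + 2 * (A : ℂ) ^ 2‖ / A ^ 2) ^ 2 =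
      (q' / A ^ 2) ^ 2 + 4 + 2 * (q' / A ^ 2) * (p / A + t / A) + 2 * (p / A + t / A) ^ 2 +
        4 * (p / A + t / A) := by
    rw [div_pow, hh, hp']; field_simp; ring
  have eg : (‖upperRoot p q ^ 2 + 2 * A * upperRoot p q + 2 * (A : ℂ) ^ 2‖ / A ^ 2) ^ 2 =
      (q / A ^ 2) ^ 2 + 4 + 2 * (q / A ^ 2) * (p / A) + 2 * (p / A) ^ 2 + 4 * (p / A) := by
    rw [div_pow, hg]; field_simp
  have ehw : ‖upperRoot p q ^ 2 - 2 * A * upperRoot p q + 2 * (A : ℂ) ^ 2‖ / A ^ 2 *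
      (‖upperRoot p q ^ 2 + 2 * A * upperRoot p q + 2 * (A : ℂ) ^ 2‖ / A ^ 2) *
      (‖upperRoot p q‖ / A) = 1 / A ^ 5 := by
    rw [div_mul_div_comm, div_mul_div_comm, hprod]; ring
  rcases hA with h1 | h2
  · have h1 : 1 / A ^ 5 = 1 := by rw [h1]; norm_num
    rw [h1] at e₅ edw edz ehw
    exact rootBounds_one hs e₅ hP hdisc e₂ e₃ e₄ (by positivity) (by positivity) (by positivity)
      (by positivity) (by positivity) (by positivity) eW eZ
      (by linear_combination edw) (by linear_combination edz) ehz eg ehw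
  · have hε : 1 / A ^ 5 ≤ 1 / 2 ^ 5 := by gcongr
    refine rootBounds_small hs ?_ e₅.symm hP hdisc e₂ e₃ e₄ (by positivity) (by positivity)
      (by positivity) (by positivity) (by positivity) (by positivity) eW eZ edw edz
      ehz eg ehw
    have : 0 < t / A * (t / A) ^ 4 := by positivity
    norm_num at hε e₅
    linarith

end QuinticFactors

lemma rpow_mul_rpow_le_mul {A W h a : ℝ} (hA : 1 ≤ A) (hW : 0 < W) (hh : 0 ≤ h) (ha : 0 ≤ a)
    (i : ℤ) (j : ℕ) (hij : i + 2 * j ≤ 4) (H : W ^ i * h ^ j ≤ a ^ 4) :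
    (A * W) ^ ((i : ℝ) / 4) * (A ^ 2 * h) ^ ((j : ℝ) / 4) ≤ A * a := by
  have hA0 : 0 < A := by linarith
  refine le_of_pow_le_pow_left₀ four_ne_zero (by positivity) ?_
  have h1 : ((A * W) ^ ((i : ℝ) / 4)) ^ 4 = (A * W) ^ i := by
    rw [← Real.rpow_natCast, ← Real.rpow_mul (by positivity), ← Real.rpow_intCast]
    norm_num
  have h2 : ((A ^ 2 * h) ^ ((j : ℝ) / 4)) ^ 4 = (A ^ 2 * h) ^ j := by
    rw [← Real.rpow_natCast, ← Real.rpow_mul (by positivity), ← Real.rpow_natCast]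
    norm_num
  have h3 : A ^ (i + 2 * j) ≤ A ^ 4 := by
    have := zpow_le_zpow_right₀ hA hij
    exact_mod_cast this
  calc _ = A ^ (i + 2 * j) * (W ^ i * h ^ j) := by
        rw [mul_pow, h1, h2, mul_zpow, mul_pow, zpow_add₀ hA0.ne', ← pow_mul]
        norm_cast
        ring
    _ ≤ A ^ 4 * a ^ 4 := by gcongr
    _ = _ := by ring

lemma rpow_mul_rpow_le_mul_pow {A t h K : ℝ} (hA : 1 ≤ A) (ht : 0 < t) (hh : 0 ≤ h) (hK : 0 ≤ K)
    (i : ℤ) (j : ℕ) (H : t ^ i * h ^ j ≤ (K * A ^ 4) ^ 4) :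
    t ^ ((i : ℝ) / 4) * h ^ ((j : ℝ) / 4) ≤ K * A ^ 4 := by
  have hA0 : 0 < A := by linarith
  refine le_of_pow_le_pow_left₀ four_ne_zero (by positivity) ?_
  have h1 : (t ^ ((i : ℝ) / 4)) ^ 4 = t ^ i := by
    rw [← Real.rpow_natCast, ← Real.rpow_mul (by positivity), ← Real.rpow_intCast]
    norm_num
  have h2 : (h ^ ((j : ℝ) / 4)) ^ 4 = h ^ j := by
    rw [← Real.rpow_natCast, ← Real.rpow_mul (by positivity), ← Real.rpow_natCast]
    norm_num
  rwa [mul_pow, h1, h2]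

lemma RootBounds.weight_lt_one {A t W Z dw dz hw hz K a b β vt vw vz : ℝ}
    (R : RootBounds W Z dw dz hw hz) (hA : 1 ≤ A) (ht : 0 < t) (htA : t ≤ 1 / 4)
    (hK : 0 ≤ K) (ha : 0 ≤ a) (hb : 0 ≤ b)
    (hvt : vt ≤ K * A ^ 4) (hvw : vw ≤ A * a) (hvz : vz ≤ A * b) (hβ : b * Z ^ 3 ≤ β * dz)
    (h0 : K / 4 + 0.1454 * a + 0.125 * b < 1) (h3 : K / 256 + 0.3766 * a + 2 * β < 1) :
    (vt * t ^ 0 / (5 * t ^ 4 + 4 * A ^ 4) + 2 * (vw * (A * W) ^ 0 / (A ^ 4 * dw)) +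
      2 * (vz * (A * Z) ^ 0 / (A ^ 4 * dz)) < 1) ∧
    (vt * t ^ 3 / (5 * t ^ 4 + 4 * A ^ 4) + 2 * (vw * (A * W) ^ 3 / (A ^ 4 * dw)) +
      2 * (vz * (A * Z) ^ 3 / (A ^ 4 * dz)) < 1) := by
  obtain ⟨hW, -, hZ, -, hdw, hdz, hW3, -, -, -, -⟩ := R
  have hA0 : 0 < A := by linarith
  have hA3 : A ≤ A ^ 4 := le_self_pow₀ hA (by norm_num)
  have hdw0 : 0 < dw := by linarith
  have hdz0 : 0 < dz := by linarith
  have hW0 : 0 < W := by linarith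
  have hZ0 : 0 < Z := by linarith
  have hD : 4 * A ^ 4 ≤ 5 * t ^ 4 + 4 * A ^ 4 := by linarith [pow_pos ht 4]
  have ht3 : t ^ 3 ≤ (1 / 4) ^ 3 := pow_le_pow_left₀ ht.le htA 3
  constructor
  · have h1 : vt * t ^ 0 / (5 * t ^ 4 + 4 * A ^ 4) ≤ K / 4 := by
      rw [div_le_iff₀ (by positivity), pow_zero, mul_one]
      nlinarith
    have h2 : vw * (A * W) ^ 0 / (A ^ 4 * dw) ≤ 0.0727 * a := by
      rw [div_le_iff₀ (by positivity), pow_zero, mul_one]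
      calc vw ≤ A * a := hvw
        _ ≤ A ^ 4 * a := by gcongr
        _ ≤ A ^ 4 * a * (0.0727 * dw) := le_mul_of_one_le_right (by positivity) (by linarith)
        _ = _ := by ring
    have h4 : vz * (A * Z) ^ 0 / (A ^ 4 * dz) ≤ 0.0625 * b := by
      rw [div_le_iff₀ (by positivity), pow_zero, mul_one]
      calc vz ≤ A * b := hvz
        _ ≤ A ^ 4 * b := by gcongr
        _ ≤ A ^ 4 * b * (0.0625 * dz) := le_mul_of_one_le_right (by positivity) (by linarith)
        _ = _ := by ring
    linarith
  · have h1 : vt * t ^ 3 / (5 * t ^ 4 + 4 * A ^ 4) ≤ K / 256 := by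
      rw [div_le_iff₀ (by positivity)]
      calc vt * t ^ 3 ≤ (K * A ^ 4) * (1 / 4) ^ 3 := by gcongr
        _ = K / 256 * (4 * A ^ 4) := by ring
        _ ≤ _ := by gcongr
    have h2 : vw * (A * W) ^ 3 / (A ^ 4 * dw) ≤ 0.1883 * a := by
      rw [div_le_iff₀ (by positivity)]
      calc vw * (A * W) ^ 3 ≤ A * a * (A * W) ^ 3 := by gcongr
        _ = A ^ 4 * a * W ^ 3 := by ring
        _ ≤ A ^ 4 * a * (0.1883 * dw) := by gcongr
        _ = _ := by ring
    have h4 : vz * (A * Z) ^ 3 / (A ^ 4 * dz) ≤ β := by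
      rw [div_le_iff₀ (by positivity)]
      calc vz * (A * Z) ^ 3 ≤ A * b * (A * Z) ^ 3 := by gcongr
        _ = A ^ 4 * (b * Z ^ 3) := by ring
        _ ≤ A ^ 4 * (β * dz) := by gcongr
        _ = _ := by ring
    linarith

/-- The multiplicative character with exponents `x`, `y` in the absolute values of `θ` and
`θ^2 - 2Aθ + 2A^2`, fed into the weights. -/
noncomputable def charWeight (A t p q p' q' : ℝ) (k : ℕ) (x y : ℝ) : ℝ :=
  weight (4 * A ^ 4) t p q p' q' k (t ^ x * (t ^ 2 - 2 * A * t + 2 * A ^ 2) ^ y)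
    (‖upperRoot p q‖ ^ x * ‖upperRoot p q ^ 2 - 2 * A * upperRoot p q + 2 * (A : ℂ) ^ 2‖ ^ y)
    (‖upperRoot p' q'‖ ^ x *
      ‖upperRoot p' q' ^ 2 - 2 * A * upperRoot p' q' + 2 * (A : ℂ) ^ 2‖ ^ y)

lemma RootBounds.pos {W Z dw dz hw hz : ℝ}
    (R : RootBounds W Z dw dz hw hz) : 0 < W ∧ 0 < Z :=
  ⟨by linarith [R.le_W], by linarith [R.le_Z]⟩

namespace QuinticFactors

variable {A t p q p' q' : ℝ}

lemma charWeight_lt_one_aux (H : QuinticFactors (4 * A ^ 4) t p q p' q') (hA : A = 1 ∨ 2 ≤ A)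
    (i : ℤ) (j : ℕ) (hij : i + 2 * j ≤ 4) {K a b β : ℝ} (hK : 0 ≤ K) (ha : 0 ≤ a)
    (hvt : t ^ i * (t ^ 2 - 2 * A * t + 2 * A ^ 2) ^ j ≤ (K * A ^ 4) ^ 4)
    (hR : ∀ {W Z dw dz hw hz : ℝ}, RootBounds W Z dw dz hw hz → 0 ≤ hw → 0 ≤ hz →
      W ^ i * hw ^ j ≤ a ^ 4 ∧ ∃ b' ≤ b, 0 ≤ b' ∧ Z ^ i * hz ^ j ≤ b' ^ 4 ∧ b' * Z ^ 3 ≤ β * dz)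
    (h0 : K / 4 + 0.1454 * a + 0.125 * b < 1) (h3 : K / 256 + 0.3766 * a + 2 * β < 1) :
    charWeight A t p q p' q' 0 (i / 4) (j / 4) < 1 ∧
      charWeight A t p q p' q' 3 (i / 4) (j / 4) < 1 := by
  have hA1 : 1 ≤ A := by rcases hA with h | h <;> linarith
  have hA0 : 0 < A := by linarith
  have R := H.rootBounds hA
  have ht := H.t_pos
  have htA : t ≤ 1 / 4 := by
    have := H.e₅
    have h4 : 1 ≤ A ^ 4 := one_le_pow₀ hA1
    nlinarith [pow_pos ht 5]
  have hht : 0 ≤ t ^ 2 - 2 * A * t + 2 * A ^ 2 := by nlinarith [sq_nonneg (t - A)]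
  obtain ⟨hW0, hZ0⟩ := R.pos
  obtain ⟨r1, b', hbb, hb', r2, r3⟩ := hR R (by positivity) (by positivity)
  have v1 := rpow_mul_rpow_le_mul_pow hA1 ht hht hK i j hvt
  have v2 := rpow_mul_rpow_le_mul hA1 hW0 (by positivity) ha i j hij r1
  have v3 := rpow_mul_rpow_le_mul hA1 hZ0 (by positivity) hb' i j hij r2
  have key := R.weight_lt_one hA1 ht htA hK ha hb' v1 v2 v3 r3 (by linarith) h3
  simp only [mul_div_cancel₀ _ hA0.ne', mul_div_cancel₀ _ (pow_ne_zero 2 hA0.ne'),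
    mul_div_cancel₀ _ (pow_ne_zero 4 hA0.ne')] at key
  exact key

end QuinticFactors

namespace QuinticFactors

variable {A t p q p' q' : ℝ}

lemma charWeight_vertices (H : QuinticFactors (4 * A ^ 4) t p q p' q') (hA : A = 1 ∨ 2 ≤ A)
    {x y : ℝ} (hxy : (x, y) ∈ ({(1 / 2, 0), (-1 / 2, 0), (-1 / 2, 1 / 2), (0, 1 / 2),
      (1 / 2, 1 / 4)} : Set (ℝ × ℝ))) :
    charWeight A t p q p' q' 0 x y < 1 ∧ charWeight A t p q p' q' 3 x y < 1 := by
  have hA1 : 1 ≤ A := by rcases hA with h | h <;> linarith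
  have hA0 : 0 < A := by linarith
  have h4 : 1 ≤ A ^ 4 := one_le_pow₀ hA1
  have ht := H.t_pos
  have e₅ := H.e₅
  have htA : t ≤ 1 / 4 := by nlinarith [pow_pos ht 5]
  have hti : t⁻¹ ≤ 4.004 * A ^ 4 := by
    have : t ^ 4 ≤ (1 / 4) ^ 4 := pow_le_pow_left₀ ht.le htA 4
    rw [inv_eq_of_mul_eq_one_right e₅]
    norm_num at this
    linarith
  have hti0 : 0 < t⁻¹ := inv_pos.mpr ht
  set h := t ^ 2 - 2 * A * t + 2 * A ^ 2 with hh
  have hh0 : 0 ≤ h := by nlinarith [sq_nonneg (t - A)]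
  have hhA : h ≤ 2 * A ^ 2 := by nlinarith
  have hhA' : h ≤ 1.57 * A ^ 4 := by
    rcases hA with h1 | h2
    · rw [h1] at e₅ hh ⊢
      have : t ^ 4 ≤ (1 / 4) ^ 4 := pow_le_pow_left₀ ht.le htA 4
      norm_num at this
      nlinarith
    · nlinarith [sq_nonneg A]
  have hbase {u K : ℝ} (hK : 0 ≤ K) (hu : u ≤ K ^ 4) : u ≤ (K * A ^ 4) ^ 4 := by
    refine hu.trans (pow_le_pow_left₀ hK (le_mul_of_one_le_right hK h4) 4)
  rcases hxy with hxy | hxy | hxy | hxy | hxy <;> obtain ⟨rfl, rfl⟩ := Prod.ext_iff.mp hxy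
  · have key := H.charWeight_lt_one_aux hA 2 0 (by norm_num) (K := 0.5) (a := 1.1893)
      (b := 1.2079) (β := 0.1785 * 1.2079) (by norm_num) (by norm_num)
      (hbase (by norm_num) <| by
        simp only [pow_zero, mul_one]
        exact (zpow_le_zpow_left₀ (by norm_num) ht.le htA).trans (by norm_num))
      (fun R _ _ ↦ ⟨by
        simp only [pow_zero, mul_one]
        exact (zpow_le_zpow_left₀ (by norm_num) R.pos.1.le R.W_le).trans (by norm_num),
        _, le_rfl, by norm_num, by
        simp only [pow_zero, mul_one]
        exact (zpow_le_zpow_left₀ (by norm_num) R.pos.2.le R.Z_le).trans (by norm_num),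
        by linarith [R.Z_cube]⟩) (by norm_num) (by norm_num)
    norm_num at key ⊢
    exact key
  · have key := H.charWeight_lt_one_aux hA (-2) 0 (by norm_num) (K := 2.002) (a := 0.8544)
      (b := 0.8422) (β := 0.1785 * 0.8422) (by norm_num) (by norm_num)
      (by
        simp only [pow_zero, mul_one, zpow_neg]
        norm_cast
        rw [← inv_pow]
        calc t⁻¹ ^ 2 ≤ (4.004 * A ^ 4) ^ 2 := by gcongr
          _ = 4.004 ^ 2 * A ^ 8 := by ring
          _ ≤ 4.004 ^ 2 * A ^ 16 := by gcongr; norm_num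
          _ ≤ _ := by rw [mul_pow, ← pow_mul]; gcongr; norm_num)
      (fun R _ _ ↦ ⟨by
        simp only [pow_zero, mul_one, zpow_neg]
        norm_cast
        have := pow_le_pow_left₀ (by norm_num) R.le_W 2
        exact (inv_anti₀ (by norm_num) this).trans (by norm_num),
        _, le_rfl, by norm_num, by
        simp only [pow_zero, mul_one, zpow_neg]
        norm_cast
        have := pow_le_pow_left₀ (by norm_num) R.le_Z 2
        exact (inv_anti₀ (by norm_num) this).trans (by norm_num),
        by linarith [R.Z_cube]⟩) (by norm_num) (by norm_num)
    norm_num at key ⊢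
    exact key
  · have key := H.charWeight_lt_one_aux hA (-2) 2 (by norm_num) (K := 2.53) (a := 0.3163)
      (b := 2.0491) (β := 0.1785 * 2.0491) (by norm_num) (by norm_num)
      (by
        simp only [zpow_neg]
        norm_cast
        rw [← inv_pow, ← hh]
        calc t⁻¹ ^ 2 * h ^ 2 ≤ (4.004 * A ^ 4) ^ 2 * (1.57 * A ^ 4) ^ 2 := by gcongr
          _ = (4.004 * 1.57) ^ 2 * A ^ 16 := by ring
          _ ≤ 2.53 ^ 4 * A ^ 16 := by gcongr; norm_num
          _ = _ := by ring)
      (fun R hw0 hz0 ↦ ⟨by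
        simp only [zpow_neg]
        norm_cast
        have h1 := inv_anti₀ (by norm_num) (pow_le_pow_left₀ (by norm_num) R.le_W 2)
        have h2 := pow_le_pow_left₀ hw0 R.hw_le 2
        exact (mul_le_mul h1 h2 (by positivity) (by norm_num)).trans (by norm_num),
        _, le_rfl, by norm_num, by
        simp only [zpow_neg]
        norm_cast
        have h1 := inv_anti₀ (by norm_num) (pow_le_pow_left₀ (by norm_num) R.le_Z 2)
        have h2 := pow_le_pow_left₀ hz0 R.hz_le 2
        exact (mul_le_mul h1 h2 (by positivity) (by norm_num)).trans (by norm_num),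
        by linarith [R.Z_cube]⟩) (by norm_num) (by norm_num)
    norm_num at key ⊢
    exact key
  · have key := H.charWeight_lt_one_aux hA 0 2 (by norm_num) (K := 1.42) (a := 0.3702)
      (b := 2.4332) (β := 0.426) (by norm_num) (by norm_num)
      (by
        rw [zpow_zero, one_mul, ← hh]
        calc h ^ 2 ≤ (2 * A ^ 2) ^ 2 := by gcongr
          _ = 2 ^ 2 * A ^ 4 := by ring
          _ ≤ 2 ^ 2 * A ^ 16 := by gcongr; norm_num
          _ ≤ _ := by rw [mul_pow, ← pow_mul]; gcongr; norm_num)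
      (fun {W Z dw dz hw hz} R hw0 hz0 ↦ ⟨by
        rw [zpow_zero, one_mul]
        exact (pow_le_pow_left₀ hw0 R.hw_le 2).trans (by norm_num),
        √hz, Real.sqrt_le_iff.mpr ⟨by norm_num, R.hz_le.trans (by norm_num)⟩, by positivity, by
        rw [zpow_zero, one_mul, show 4 = 2 * 2 from rfl, pow_mul, Real.sq_sqrt hz0],
        by
        refine le_of_sq_le ?_ (by linarith [R.le_dz])
        rw [mul_pow, Real.sq_sqrt hz0]
        exact R.hz_Z⟩) (by norm_num) (by norm_num)
    norm_num at key ⊢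
    exact key
  · have key := H.charWeight_lt_one_aux hA 2 1 (by norm_num) (K := 1) (a := 0.7236)
      (b := 1.8842) (β := 0.1785 * 1.8842) (by norm_num) (by norm_num)
      (by
        rw [← hh]
        norm_cast
        calc t ^ 2 * h ^ 1 ≤ (1 / 4) ^ 2 * (1.57 * A ^ 4) ^ 1 := by gcongr
          _ ≤ 1 * A ^ 4 := by rw [pow_one, ← mul_assoc]; gcongr; norm_num
          _ ≤ _ := by
            rw [one_mul, ← pow_mul]
            gcongr; norm_num)
      (fun R hw0 hz0 ↦ ⟨by
        norm_cast
        have h1 := pow_le_pow_left₀ R.pos.1.le R.W_le 2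
        rw [pow_one]
        exact (mul_le_mul h1 R.hw_le hw0 (by norm_num)).trans (by norm_num),
        _, le_rfl, by norm_num, by
        norm_cast
        have h1 := pow_le_pow_left₀ R.pos.2.le R.Z_le 2
        rw [pow_one]
        exact (mul_le_mul h1 R.hz_le hz0 (by norm_num)).trans (by norm_num),
        by linarith [R.Z_cube]⟩) (by norm_num) (by norm_num)
    norm_num at key ⊢
    exact key

end QuinticFactors

lemma convexOn_rpow_mul_rpow {a h C : ℝ} (ha : 0 < a) (hh : 0 < h) (hC : 0 ≤ C) :
    ConvexOn ℝ Set.univ fun v : ℝ × ℝ ↦ C * (a ^ v.1 * h ^ v.2) := by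
  have h1 := (convexOn_exp.comp_linearMap
    (Real.log a • LinearMap.fst ℝ ℝ ℝ + Real.log h • LinearMap.snd ℝ ℝ ℝ)).smul hC
  refine h1.congr fun v _ ↦ ?_
  simp [Real.rpow_def_of_pos ha, Real.rpow_def_of_pos hh, Real.exp_add]

lemma Convex.mem_of_eq_add {S : Set (ℝ × ℝ)} (hS : Convex ℝ S) {a b a' b' : ℝ}
    (h : (a, b) ∈ S) (h' : (a', b') ∈ S) {x y r : ℝ} (hr : 0 ≤ r) (hr' : r ≤ 1)
    (hx : x = (1 - r) * a + r * a') (hy : y = (1 - r) * b + r * b') : (x, y) ∈ S := by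
  have := hS h h' (sub_nonneg.mpr hr') hr (by ring)
  simpa [hx, hy] using this

lemma Convex.pentagon_subset {S : Set (ℝ × ℝ)} (hS : Convex ℝ S)
    (hV : ({(1 / 2, 0), (-1 / 2, 0), (-1 / 2, 1 / 2), (0, 1 / 2), (1 / 2, 1 / 4)} :
      Set (ℝ × ℝ)) ⊆ S)
    {x y : ℝ} (hx : -1 / 2 ≤ x) (hx' : x ≤ 1 / 2) (hy : 0 ≤ y) (hxy : x ≤ 1 - 2 * y)
    (hy' : y ≤ 1 / 2) : (x, y) ∈ S := by
  simp only [Set.insert_subset_iff, Set.singleton_subset_iff] at hV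
  obtain ⟨h1, h2, h3, h4, h5⟩ := hV
  have hl : (-1 / 2, y) ∈ S := hS.mem_of_eq_add h2 h3 (r := 2 * y) (by linarith) (by linarith)
    (by ring) (by ring)
  have hseg {e : ℝ} (he : (e, y) ∈ S) (he' : 0 ≤ e) (hxe : x ≤ e) : (x, y) ∈ S :=
    hS.mem_of_eq_add hl he (r := (x + 1 / 2) / (e + 1 / 2)) (by apply div_nonneg <;> linarith)
      (div_le_one_of_le₀ (by linarith) (by linarith)) (by field_simp; ring) (by ring)
  rcases le_total y (1 / 4) with h | h
  · refine hseg (e := 1 / 2) ?_ (by norm_num) hx'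
    exact hS.mem_of_eq_add h1 h5 (r := 4 * y) (by linarith) (by linarith) (by ring) (by ring)
  · refine hseg (e := 1 - 2 * y) ?_ (by linarith) hxy
    exact hS.mem_of_eq_add h5 h4 (r := 4 * y - 1) (by linarith) (by linarith) (by ring) (by ring)

namespace QuinticFactors

variable {A t p q p' q' : ℝ}

lemma norm_mul_norm_mul_norm {x : ℂ} (hx : x ^ 5 + (4 * A ^ 4 : ℝ) * x - 1 = 0) :
    ‖x ^ 2 - 2 * A * x + 2 * (A : ℂ) ^ 2‖ * ‖x ^ 2 + 2 * A * x + 2 * (A : ℂ) ^ 2‖ * ‖x‖ = 1 := by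
  rw [← norm_mul, ← norm_mul, ← norm_one (α := ℂ)]
  push_cast at hx
  exact congrArg norm (by linear_combination hx)

lemma charWeight_lt_one (H : QuinticFactors (4 * A ^ 4) t p q p' q') (hA : A = 1 ∨ 2 ≤ A)
    {x y : ℝ} (hx : -1 / 2 ≤ x) (hx' : x ≤ 1 / 2) (hy : 0 ≤ y) (hxy : x ≤ 1 - 2 * y)
    (hy' : y ≤ 1 / 2) :
    charWeight A t p q p' q' 0 x y < 1 ∧ charWeight A t p q p' q' 3 x y < 1 := by
  have hA0 : 0 < A := by rcases hA with h | h <;> linarith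
  have ht := H.t_pos
  have hht : 0 < t ^ 2 - 2 * A * t + 2 * A ^ 2 := by nlinarith [sq_nonneg (t - A)]
  have hpos {x : ℂ} (hx : x ^ 5 + (4 * A ^ 4 : ℝ) * x - 1 = 0) :
      0 < ‖x‖ ∧ 0 < ‖x ^ 2 - 2 * A * x + 2 * (A : ℂ) ^ 2‖ := by
    have h := norm_mul_norm_mul_norm hx
    constructor <;> refine lt_of_le_of_ne (norm_nonneg _) fun h0 ↦ ?_ <;> simp [← h0] at h
  obtain ⟨hw, hhw⟩ := hpos H.upperRoot_eq_zero
  obtain ⟨hz, hhz⟩ := hpos H.upperRoot'_eq_zero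
  have hconv (k : ℕ) : ConvexOn ℝ Set.univ
      fun v : ℝ × ℝ ↦ charWeight A t p q p' q' k v.1 v.2 := by
    have c1 := convexOn_rpow_mul_rpow ht hht (C := t ^ k / (5 * t ^ 4 + 4 * A ^ 4)) (by positivity)
    have c2 := convexOn_rpow_mul_rpow hw hhw (C := 2 * (‖upperRoot p q‖ ^ k /
      ‖5 * upperRoot p q ^ 4 + (4 * A ^ 4 : ℝ)‖)) (by positivity)
    have c3 := convexOn_rpow_mul_rpow hz hhz (C := 2 * (‖upperRoot p' q'‖ ^ k /
      ‖5 * upperRoot p' q' ^ 4 + (4 * A ^ 4 : ℝ)‖)) (by positivity)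
    refine ((c1.add c2).add c3).congr fun v _ ↦ ?_
    simp only [charWeight, weight, Pi.add_apply]
    ring
  have := (((hconv 0).convex_lt 1).inter ((hconv 3).convex_lt 1)).pentagon_subset
    (fun v hv ↦ by simpa using H.charWeight_vertices hA hv) hx hx' hy hxy hy'
  simpa using this

end QuinticFactors

/-- A simultaneous approximation argument: if elements whose coordinates lie in a suitable pentagon
are trivial, then every element with coordinates is a product of powers of `θ` and `h`. -/
lemma exists_zpow_mul_zpow {G : Type*} [CommGroup G] (θ h : G) (E : G → ℝ → ℝ → Prop)
    (hmul : ∀ {u v x y x' y'}, E u x y → E v x' y' → E (u * v) (x + x') (y + y'))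
    (hpow : ∀ {u x y} (n : ℤ), E u x y → E (u ^ n) (n * x) (n * y))
    (hroot : ∀ {u x y x' y'} {n : ℤ}, n ≠ 0 → E u x y → E (u ^ n) x' y' → E u (x' / n) (y' / n))
    (hθ : E θ 1 0) (hh : E h 0 1)
    (hsmall : ∀ {u x y}, E u x y → -1 / 2 ≤ x → x ≤ 1 / 2 → 0 ≤ y → x ≤ 1 - 2 * y → y ≤ 1 / 2 →
      u = 1) {u : G} {x y : ℝ} (hu : E u x y) : ∃ a e : ℤ, u = θ ^ a * h ^ e := by
  have hlat (a e : ℤ) : E (θ ^ a * h ^ e) a e := by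
    simpa using hmul (hpow a hθ) (hpow e hh)
  have hshift {u x y} (hu : E u x y) (a e : ℤ) (h1 : -1 / 2 ≤ x - a) (h2 : x - a ≤ 1 / 2)
      (h3 : 0 ≤ y - e) (h4 : x - a ≤ 1 - 2 * (y - e)) (h5 : y - e ≤ 1 / 2) :
      u = θ ^ a * h ^ e := by
    have h0 := hmul hu (hpow (-1) (hlat a e))
    have := hsmall h0 (by push_cast; linarith) (by push_cast; linarith) (by push_cast; linarith)
      (by push_cast; linarith) (by push_cast; linarith)
    rwa [zpow_neg_one, mul_inv_eq_one] at this
  have hinv (hu : ∃ a e : ℤ, u⁻¹ = θ ^ a * h ^ e) : ∃ a e : ℤ, u = θ ^ a * h ^ e := by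
    obtain ⟨a, e, h⟩ := hu
    exact ⟨-a, -e, by rw [zpow_neg, zpow_neg, ← mul_inv, ← h, inv_inv]⟩
  obtain ⟨K, a, e, hK, hK3, hE⟩ : ∃ K a e : ℤ, 0 < K ∧ K ≤ 3 ∧ E u (a / K) (e / K) := by
    obtain ⟨e, k, hk, hk3, hek⟩ := Real.exists_int_int_abs_mul_sub_le y (n := 3) (by norm_num)
    norm_num at hek
    obtain ⟨hek1, hek2⟩ := abs_le.mp hek
    rcases le_total 0 (k * y - e) with h | h
    · have hr := abs_le.mp (abs_sub_round ((k : ℝ) * x))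
      have hE := hpow k hu
      have := hshift hE (round ((k : ℝ) * x)) e (by linarith) (by linarith) h (by linarith)
        (by linarith)
      exact ⟨k, _, _, hk, by exact_mod_cast hk3, hroot hk.ne' hu (this ▸ hlat _ _)⟩
    · have hr := abs_le.mp (abs_sub_round ((-k : ℝ) * x))
      have hE := hpow (-k) hu
      have := hshift hE (round ((-k : ℝ) * x)) (-e) (by push_cast; linarith)
        (by push_cast; linarith) (by push_cast; linarith) (by push_cast; linarith)
        (by push_cast; linarith)
      refine ⟨k, -round ((-k : ℝ) * x), e, hk, by exact_mod_cast hk3, ?_⟩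
      have := hroot (by omega) hu (this ▸ hlat (round ((-k : ℝ) * x)) (-e))
      push_cast at this ⊢
      rwa [neg_div_neg_eq, div_neg, ← neg_div] at this
  have hE' := hpow (-1) hE
  rw [zpow_neg_one] at hE'
  obtain rfl | rfl | rfl : K = 1 ∨ K = 2 ∨ K = 3 := by omega
  · exact ⟨a, e, hshift hE a e (by norm_num) (by norm_num) (by norm_num) (by norm_num)
      (by norm_num)⟩
  · obtain ⟨a', i, rfl, hi⟩ : ∃ a' i : ℤ, a = 2 * a' + i ∧ (i = 0 ∨ i = -1) :=
      ⟨(a + 1) / 2, a - 2 * ((a + 1) / 2), by omega, by omega⟩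
    obtain ⟨e', j, rfl, hj⟩ : ∃ e' j : ℤ, e = 2 * e' + j ∧ (j = 0 ∨ j = 1) :=
      ⟨e / 2, e % 2, by omega, by omega⟩
    refine ⟨a', e', hshift hE a' e' ?_ ?_ ?_ ?_ ?_⟩ <;>
      rcases hi with rfl | rfl <;> rcases hj with rfl | rfl <;> push_cast <;> linarith
  · obtain ⟨a', i, rfl, hi⟩ : ∃ a' i : ℤ, a = 3 * a' + i ∧ (i = 0 ∨ i = -1 ∨ i = 1) :=
      ⟨(a + 1) / 3, a - 3 * ((a + 1) / 3), by omega, by omega⟩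
    obtain ⟨e', j, rfl, hj⟩ : ∃ e' j : ℤ, e = 3 * e' + j ∧ (j = 0 ∨ j = 1 ∨ j = -1) :=
      ⟨(e + 1) / 3, e - 3 * ((e + 1) / 3), by omega, by omega⟩
    rcases hj with hj | hj | rfl
    · subst hj
      refine ⟨a', e', hshift hE a' e' ?_ ?_ ?_ ?_ ?_⟩ <;>
        rcases hi with rfl | rfl | rfl <;> push_cast <;> linarith
    · subst hj
      refine ⟨a', e', hshift hE a' e' ?_ ?_ ?_ ?_ ?_⟩ <;>
        rcases hi with rfl | rfl | rfl <;> push_cast <;> linarith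
    · refine hinv ⟨-a', -e', hshift hE' (-a') (-e') ?_ ?_ ?_ ?_ ?_⟩ <;>
        rcases hi with rfl | rfl | rfl <;> push_cast <;> linarith

namespace QuinticFactors

variable {c A t p q p' q' : ℝ}

lemma binary_form_eq (H : QuinticFactors c t p q p' q') (x y : ℝ) :
    (x - y * t) * (x ^ 2 - x * y * p + y ^ 2 * q) * (x ^ 2 - x * y * p' + y ^ 2 * q') =
      x ^ 5 + c * x * y ^ 4 - y ^ 5 := by
  linear_combination (x - y * t) * (-x ^ 3 * y * H.e₁ + x ^ 2 * y ^ 2 * H.e₂ - x * y ^ 3 * H.e₃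
    + y ^ 4 * H.e₄) - y ^ 5 * H.e₅

lemma quadratic_norm_eq_one (H : QuinticFactors (4 * A ^ 4) t p q p' q') :
    (t ^ 2 - 2 * A * t + 2 * A ^ 2) *
      ‖upperRoot p q ^ 2 - 2 * A * upperRoot p q + 2 * (A : ℂ) ^ 2‖ ^ 2 *
      ‖upperRoot p' q' ^ 2 - 2 * A * upperRoot p' q' + 2 * (A : ℂ) ^ 2‖ ^ 2 = 1 := by
  have hn {p q : ℝ} (h : p ^ 2 < 4 * q) :
      ‖upperRoot p q ^ 2 - 2 * A * upperRoot p q + 2 * (A : ℂ) ^ 2‖ ^ 2 =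
        (q - p * A) ^ 2 + (2 * A ^ 2 - p * A) ^ 2 := by
    have := normSq_quadratic h (-A)
    push_cast at this
    rw [show upperRoot p q ^ 2 - 2 * A * upperRoot p q + 2 * (A : ℂ) ^ 2 =
      upperRoot p q ^ 2 + 2 * -A * upperRoot p q + 2 * (-A : ℂ) ^ 2 by ring, this]
    ring
  have e₁ : (t : ℂ) + p + p' = 0 := by exact_mod_cast H.e₁
  have e₂ : (q : ℂ) + q' + p * p' = t ^ 2 := by exact_mod_cast H.e₂
  have e₃ : (q : ℂ) * p' + q' * p = -t ^ 3 := by exact_mod_cast H.e₃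
  have e₄ : (q : ℂ) * q' = 4 * A ^ 4 + t ^ 4 := by exact_mod_cast H.e₄
  have e₅ : (t : ℂ) * (4 * A ^ 4 + t ^ 4) = 1 := by exact_mod_cast H.e₅
  have hprod (x : ℂ) : (x - t) * (x ^ 2 - p * x + q) * (x ^ 2 - p' * x + q') =
      x * (x ^ 4 + 4 * A ^ 4) - 1 := by
    linear_combination (x - t) * (-x ^ 3 * e₁ + x ^ 2 * e₂ - x * e₃ + e₄) - e₅
  have h := hprod (⟨A, A⟩ : ℂ)
  have hx : (⟨A, A⟩ : ℂ) ^ 2 = ⟨0, 2 * A ^ 2⟩ := by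
    apply Complex.ext <;> simp [pow_two]; ring
  have hx4 : (⟨A, A⟩ : ℂ) ^ 4 + 4 * A ^ 4 = 0 := by
    have hI : (⟨0, 2 * A ^ 2⟩ : ℂ) = 2 * A ^ 2 * Complex.I := by
      apply Complex.ext <;> simp [← Complex.ofReal_pow]
    rw [hI] at hx
    linear_combination ((⟨A, A⟩ : ℂ) ^ 2 + 2 * A ^ 2 * Complex.I) * hx + 4 * A ^ 4 * Complex.I_sq
  rw [hx4, hx] at h
  have h' := congrArg Complex.normSq h
  simp only [map_mul] at h'
  rw [hn H.disc, hn H.disc']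
  simp [Complex.normSq_apply] at h'
  linear_combination h'

end QuinticFactors

section rpow

variable {T H : ℝ}

lemma rpow_mul_rpow_add (hT : 0 < T) (hH : 0 < H) (x y x' y' : ℝ) :
    T ^ (x + x') * H ^ (y + y') = T ^ x * H ^ y * (T ^ x' * H ^ y') := by
  rw [Real.rpow_add hT, Real.rpow_add hH]
  ring

lemma rpow_mul_rpow_zpow (hT : 0 < T) (hH : 0 < H) (x y : ℝ) (n : ℤ) :
    (T ^ x * H ^ y) ^ n = T ^ (n * x) * H ^ (n * y) := by
  rw [mul_zpow, ← Real.rpow_intCast, ← Real.rpow_intCast, ← Real.rpow_mul hT.le,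
    ← Real.rpow_mul hH.le, mul_comm x, mul_comm y]

lemma eq_rpow_mul_rpow_of_zpow_eq (hT : 0 < T) (hH : 0 < H) {v x y : ℝ} {n : ℤ} (hv : 0 ≤ v)
    (hn : n ≠ 0) (h : v ^ n = T ^ x * H ^ y) : v = T ^ (x / n) * H ^ (y / n) := by
  have hn' : (n : ℝ) ≠ 0 := by exact_mod_cast hn
  have h' := rpow_mul_rpow_zpow hT hH (x / n) (y / n) n
  rw [mul_div_cancel₀ _ hn', mul_div_cancel₀ _ hn', ← h] at h'
  exact (zpow_left_injOn₀ hn hv (show 0 ≤ T ^ (x / n) * H ^ (y / n) by positivity) h'.symm)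

lemma mul_sq_mul_sq_rpow {a b c : ℝ} (ha : 0 ≤ a) (hb : 0 ≤ b) (hc : 0 ≤ c) (x : ℝ) :
    (a * b ^ 2 * c ^ 2) ^ x = a ^ x * (b ^ x) ^ 2 * (c ^ x) ^ 2 := by
  rw [Real.mul_rpow (by positivity) (by positivity), Real.mul_rpow ha (by positivity),
    Real.rpow_pow_comm hb, Real.rpow_pow_comm hc]

lemma exists_rpow_mul_rpow {T' H' v v' : ℝ} (hT : 0 < T) (hH : 0 < H) (hT' : 0 < T') (hH' : 0 < H')
    (hv : 0 < v) (hv' : 0 < v')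
    (hdet : Real.log T * Real.log H' - Real.log T' * Real.log H ≠ 0) :
    ∃ x y : ℝ, v = T ^ x * H ^ y ∧ v' = T' ^ x * H' ^ y := by
  set D := Real.log T * Real.log H' - Real.log T' * Real.log H with hD
  refine ⟨(Real.log v * Real.log H' - Real.log v' * Real.log H) / D,
    (Real.log T * Real.log v' - Real.log T' * Real.log v) / D, ?_, ?_⟩
  · rw [Real.rpow_def_of_pos hT, Real.rpow_def_of_pos hH, ← Real.exp_add]
    refine (Real.exp_log hv).symm.trans (congrArg _ ?_)
    field_simp
    rw [hD]
    ring
  · rw [Real.rpow_def_of_pos hT', Real.rpow_def_of_pos hH', ← Real.exp_add]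
    refine (Real.exp_log hv').symm.trans (congrArg _ ?_)
    field_simp
    rw [hD]
    ring

end rpow

lemma QuinticFactors.log_det_ne_zero {A t p q p' q' : ℝ}
    (H : QuinticFactors (4 * A ^ 4) t p q p' q') (hA : A = 1 ∨ 2 ≤ A) :
    Real.log ‖upperRoot p q‖ *
        Real.log ‖upperRoot p' q' ^ 2 - 2 * A * upperRoot p' q' + 2 * (A : ℂ) ^ 2‖ -
      Real.log ‖upperRoot p' q'‖ *
        Real.log ‖upperRoot p q ^ 2 - 2 * A * upperRoot p q + 2 * (A : ℂ) ^ 2‖ ≠ 0 := by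
  have hA1 : 1 ≤ A := by rcases hA with h | h <;> linarith
  have hA0 : 0 < A := by linarith
  have hp := H.p_pos
  have hp' := H.p'_neg
  have hA4 : 1 ≤ A ^ 4 := one_le_pow₀ hA1
  have R := H.rootBounds hA
  have hw : 1 < ‖upperRoot p q‖ := by
    have := (le_div_iff₀ hA0).mp R.le_W
    linarith
  have hz : 1 < ‖upperRoot p' q'‖ := by
    have := (le_div_iff₀ hA0).mp R.le_Z
    linarith
  have hq : 0 < q := by nlinarith [H.disc, sq_nonneg p]
  have hq' : 0 < q' := by nlinarith [H.disc', sq_nonneg p']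
  have hhz : 1 < ‖upperRoot p' q' ^ 2 - 2 * A * upperRoot p' q' + 2 * (A : ℂ) ^ 2‖ := by
    have h := normSq_quadratic H.disc' (-A)
    push_cast at h
    rw [show upperRoot p' q' ^ 2 + 2 * -A * upperRoot p' q' + 2 * (-A : ℂ) ^ 2 =
      upperRoot p' q' ^ 2 - 2 * A * upperRoot p' q' + 2 * (A : ℂ) ^ 2 by ring] at h
    refine lt_of_pow_lt_pow_left₀ 2 (norm_nonneg _) ?_
    rw [h]
    have : 0 < A * q' * -p' := by have := neg_pos.mpr hp'; positivity
    have : 0 < A ^ 3 * -p' := by have := neg_pos.mpr hp'; positivity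
    nlinarith [sq_nonneg q', sq_nonneg (A * p')]
  have hgw : 1 < ‖upperRoot p q ^ 2 + 2 * A * upperRoot p q + 2 * (A : ℂ) ^ 2‖ := by
    refine lt_of_pow_lt_pow_left₀ 2 (norm_nonneg _) ?_
    rw [normSq_quadratic H.disc A]
    have : 0 < A * p * q := by positivity
    have : 0 < A ^ 3 * p := by positivity
    nlinarith [sq_nonneg q, sq_nonneg (A * p)]
  have hprod := norm_mul_norm_mul_norm H.upperRoot_eq_zero
  have hhw : ‖upperRoot p q ^ 2 - 2 * A * upperRoot p q + 2 * (A : ℂ) ^ 2‖ < 1 := by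
    set a := ‖upperRoot p q ^ 2 - 2 * A * upperRoot p q + 2 * (A : ℂ) ^ 2‖
    have ha : 0 ≤ a := norm_nonneg _
    by_contra! h
    nlinarith [mul_lt_mul'' hgw hw zero_le_one zero_le_one]
  have h1 := mul_pos (Real.log_pos hw) (Real.log_pos hhz)
  have h2 := mul_nonpos_of_nonneg_of_nonpos (Real.log_pos hz).le
    (Real.log_nonpos (norm_nonneg _) hhw.le)
  linarith

/-- The norm of `ℤ[X]/(X^5 + 4b^4X - 1)`, computed from a real and two complex embeddings. -/
noncomputable def quinticNorm {b : ℤ} {t : ℝ} {w z : ℂ} (ht : t ^ 5 + 4 * (b : ℝ) ^ 4 * t - 1 = 0)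
    (hw : w ^ 5 + 4 * (b : ℂ) ^ 4 * w - 1 = 0) (hz : z ^ 5 + 4 * (b : ℂ) ^ 4 * z - 1 = 0) :
    AdjoinRoot (thuePoly b) →* ℝ where
  toFun u := evalRoot b t ht u * ‖evalRoot b w hw u‖ ^ 2 * ‖evalRoot b z hz u‖ ^ 2
  map_one' := by simp
  map_mul' u v := by simp only [map_mul, norm_mul]; ring

lemma quinticNorm_apply {b : ℤ} {t : ℝ} {w z : ℂ} (ht : t ^ 5 + 4 * (b : ℝ) ^ 4 * t - 1 = 0)
    (hw : w ^ 5 + 4 * (b : ℂ) ^ 4 * w - 1 = 0) (hz : z ^ 5 + 4 * (b : ℂ) ^ 4 * z - 1 = 0)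
    (u : AdjoinRoot (thuePoly b)) : quinticNorm ht hw hz u =
      evalRoot b t ht u * ‖evalRoot b w hw u‖ ^ 2 * ‖evalRoot b z hz u‖ ^ 2 := rfl

lemma evalRoot_ofReal {b : ℤ} {t : ℝ} (ht : t ^ 5 + 4 * (b : ℝ) ^ 4 * t - 1 = 0)
    (ht' : (t : ℂ) ^ 5 + 4 * (b : ℂ) ^ 4 * t - 1 = 0) (β : AdjoinRoot (thuePoly b)) :
    evalRoot b (t : ℂ) ht' β = (evalRoot b t ht β : ℝ) := by
  obtain ⟨a, rfl⟩ := exists_eq_sum_root b β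
  simp

lemma root_pow_five (b : ℤ) : AdjoinRoot.root (thuePoly b) ^ 5 +
    4 * (b : AdjoinRoot (thuePoly b)) ^ 4 * AdjoinRoot.root (thuePoly b) - 1 = 0 := by
  have h : eval₂ (AdjoinRoot.of (thuePoly b)) (AdjoinRoot.root (thuePoly b))
      (X ^ 5 + C (4 * b ^ 4) * X - 1) = 0 := AdjoinRoot.eval₂_root (thuePoly b)
  simp only [eval₂_sub, eval₂_add, eval₂_mul, eval₂_X_pow, eval₂_X, eval₂_C, eval₂_one] at h
  simpa using h

lemma map_val_zpow {R K : Type*} [CommRing R] [Field K] (f : R →+* K) (v : Rˣ) (n : ℤ) :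
    f ((v ^ n : Rˣ) : R) = f v ^ n := by
  have := congrArg Units.val (map_zpow (Units.map (f : R →* K)) v n)
  rwa [Units.val_zpow_eq_zpow_val] at this

theorem norm_form_eq_one_iff {b : ℤ} (hb : 1 ≤ b) {θ h : (AdjoinRoot (thuePoly b))ˣ}
    (hθ : (θ : AdjoinRoot (thuePoly b)) = AdjoinRoot.root (thuePoly b))
    (hh : (h : AdjoinRoot (thuePoly b)) = AdjoinRoot.root (thuePoly b) ^ 2 -
      2 * (b : AdjoinRoot (thuePoly b)) * AdjoinRoot.root (thuePoly b) +
      2 * (b : AdjoinRoot (thuePoly b)) ^ 2) (m n : ℤ) :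
    m ^ 5 + 4 * b ^ 4 * m * n ^ 4 - n ^ 5 = 1 ↔ ∃ n₁ n₂ : ℤ,
      (m : AdjoinRoot (thuePoly b)) -
          (n : AdjoinRoot (thuePoly b)) * AdjoinRoot.root (thuePoly b) =
        ((θ ^ n₁ * h ^ n₂ : (AdjoinRoot (thuePoly b))ˣ) : AdjoinRoot (thuePoly b)) := by
  have hb' : (1 : ℝ) ≤ b := by exact_mod_cast hb
  have hA : (b : ℝ) = 1 ∨ 2 ≤ (b : ℝ) := by
    have : b = 1 ∨ 2 ≤ b := by omega
    exact_mod_cast this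
  have hb4 : (1 : ℝ) ≤ (b : ℝ) ^ 4 := one_le_pow₀ hb'
  obtain ⟨t, p, q, p', q', H⟩ := exists_quinticFactors (c := 4 * (b : ℝ) ^ 4) (by linarith)
  have ht := H.t_pos
  have h0 := H.root_eq_zero
  have h1 := H.upperRoot_eq_zero
  have h2 := H.upperRoot'_eq_zero
  have h0' : (t : ℂ) ^ 5 + 4 * (b : ℂ) ^ 4 * t - 1 = 0 := by exact_mod_cast h0
  push_cast at h1 h2
  have Nθ : quinticNorm h0 h1 h2 θ = 1 := by
    simp only [quinticNorm_apply, hθ, evalRoot_root, norm_upperRoot H.disc, norm_upperRoot H.disc']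
    linear_combination t * H.e₄ + H.e₅
  have Nh : quinticNorm h0 h1 h2 h = 1 := by
    have := H.quadratic_norm_eq_one
    push_cast at this
    simpa [quinticNorm_apply, hh, map_ofNat] using this
  have Nmn : quinticNorm h0 h1 h2 (m - n * AdjoinRoot.root (thuePoly b)) =
      ((m ^ 5 + 4 * b ^ 4 * m * n ^ 4 - n ^ 5 : ℤ) : ℝ) := by
    have e1 := normSq_add_mul_upperRoot H.disc m (-n)
    have e2 := normSq_add_mul_upperRoot H.disc' m (-n)
    push_cast at e1 e2
    simp only [neg_mul, ← sub_eq_add_neg] at e1 e2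
    simp only [quinticNorm_apply, map_sub, map_mul, map_intCast, evalRoot_root, e1, e2]
    push_cast
    linear_combination H.binary_form_eq m n
  constructor
  swap
  · rintro ⟨n₁, n₂, heq⟩
    have h3 : Units.map (quinticNorm h0 h1 h2) (θ ^ n₁ * h ^ n₂) = 1 := by
      have e1 : Units.map (quinticNorm h0 h1 h2) θ = 1 := Units.ext Nθ
      have e2 : Units.map (quinticNorm h0 h1 h2) h = 1 := Units.ext Nh
      rw [map_mul, map_zpow, map_zpow, e1, e2, one_zpow, one_zpow, one_mul]
    have h4 := congrArg Units.val h3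
    rw [Units.coe_map, ← heq, Units.val_one] at h4
    exact Int.cast_eq_one.mp (Nmn.symm.trans h4)
  intro heq
  rw [heq, Int.cast_one] at Nmn
  obtain ⟨u, hu⟩ : IsUnit ((m : AdjoinRoot (thuePoly b)) - n * AdjoinRoot.root (thuePoly b)) := by
    have heq' := congrArg (Int.cast (R := AdjoinRoot (thuePoly b))) heq
    push_cast at heq'
    have hr := root_pow_five b
    set r := AdjoinRoot.root (thuePoly b)
    refine IsUnit.of_mul_eq_one ((m : AdjoinRoot (thuePoly b)) ^ 4 + m ^ 3 * n * r +
      m ^ 2 * n ^ 2 * r ^ 2 + m * n ^ 3 * r ^ 3 + n ^ 4 * r ^ 4 + 4 * b ^ 4 * n ^ 4) ?_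
    linear_combination heq' - n ^ 5 * hr
  suffices ∃ n₁ n₂ : ℤ, u = θ ^ n₁ * h ^ n₂ by
    obtain ⟨n₁, n₂, h3⟩ := this
    exact ⟨n₁, n₂, by rw [← hu, h3]⟩
  rw [← hu] at Nmn
  have hφθ : evalRoot b t h0 θ = t := by simp [hθ]
  have hψθ : evalRoot b _ h1 θ = upperRoot p q := by simp [hθ]
  have hχθ : evalRoot b _ h2 θ = upperRoot p' q' := by simp [hθ]
  have hφh : evalRoot b t h0 h = t ^ 2 - 2 * b * t + 2 * (b : ℝ) ^ 2 := by
    simp [hh, map_ofNat]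
  have hψh : evalRoot b _ h1 h =
      upperRoot p q ^ 2 - 2 * (b : ℝ) * upperRoot p q + 2 * ((b : ℝ) : ℂ) ^ 2 := by
    simp [hh, map_ofNat]
  have hχh : evalRoot b _ h2 h =
      upperRoot p' q' ^ 2 - 2 * (b : ℝ) * upperRoot p' q' + 2 * ((b : ℝ) : ℂ) ^ 2 := by
    simp [hh, map_ofNat]
  have hψ0 (v : (AdjoinRoot (thuePoly b))ˣ) : 0 < ‖evalRoot b _ h1 v‖ :=
    norm_pos_iff.mpr (v.isUnit.map (evalRoot b _ h1)).ne_zero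
  have hχ0 (v : (AdjoinRoot (thuePoly b))ˣ) : 0 < ‖evalRoot b _ h2 v‖ :=
    norm_pos_iff.mpr (v.isUnit.map (evalRoot b _ h2)).ne_zero
  have ht0 : 0 < evalRoot b t h0 θ := by rwa [hφθ]
  have hh0 : 0 < evalRoot b t h0 h := by
    rw [hφh]
    nlinarith [sq_nonneg (t - b)]
  set φ := evalRoot b t h0
  set ψ := evalRoot b _ h1
  set χ := evalRoot b _ h2
  set E : (AdjoinRoot (thuePoly b))ˣ → ℝ → ℝ → Prop := fun v x y ↦
    φ v = φ θ ^ x * φ h ^ y ∧ ‖ψ v‖ = ‖ψ θ‖ ^ x * ‖ψ h‖ ^ y ∧ ‖χ v‖ = ‖χ θ‖ ^ x * ‖χ h‖ ^ y with hE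
  have hprod (x y : ℝ) : φ θ ^ x * φ h ^ y * (‖ψ θ‖ ^ x * ‖ψ h‖ ^ y) ^ 2 *
      (‖χ θ‖ ^ x * ‖χ h‖ ^ y) ^ 2 = 1 := by
    rw [quinticNorm_apply] at Nθ Nh
    calc _ = (φ θ * ‖ψ θ‖ ^ 2 * ‖χ θ‖ ^ 2) ^ x * (φ h * ‖ψ h‖ ^ 2 * ‖χ h‖ ^ 2) ^ y := by
          rw [mul_sq_mul_sq_rpow ht0.le (norm_nonneg _) (norm_nonneg _),
            mul_sq_mul_sq_rpow hh0.le (norm_nonneg _) (norm_nonneg _)]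
          ring
      _ = 1 := by rw [Nθ, Nh, Real.one_rpow, Real.one_rpow, one_mul]
  obtain ⟨x, y, hψu, hχu⟩ := exists_rpow_mul_rpow (hψ0 θ) (hψ0 h) (hχ0 θ) (hχ0 h) (hψ0 u) (hχ0 u)
    (by rw [hψθ, hψh, hχθ, hχh]; exact H.log_det_ne_zero hA)
  have hu : E u x y := by
    refine ⟨?_, hψu, hχu⟩
    have h3 := hprod x y
    rw [quinticNorm_apply] at Nmn
    rw [← hψu, ← hχu, ← Nmn] at h3
    have h4 := (hψ0 u).ne'
    have h5 := (hχ0 u).ne'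
    exact (mul_right_cancel₀ (pow_ne_zero 2 h4) (mul_right_cancel₀ (pow_ne_zero 2 h5) h3)).symm
  refine exists_zpow_mul_zpow θ h E ?_ ?_ ?_ ?_ ?_ ?_ hu
  · rintro v v' x y x' y' ⟨a1, a2, a3⟩ ⟨c1, c2, c3⟩
    refine ⟨?_, ?_, ?_⟩
    · rw [Units.val_mul, map_mul, a1, c1, rpow_mul_rpow_add ht0 hh0]
    · rw [Units.val_mul, map_mul, norm_mul, a2, c2, rpow_mul_rpow_add (hψ0 θ) (hψ0 h)]
    · rw [Units.val_mul, map_mul, norm_mul, a3, c3, rpow_mul_rpow_add (hχ0 θ) (hχ0 h)]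
  · rintro v x y k ⟨a1, a2, a3⟩
    refine ⟨?_, ?_, ?_⟩
    · rw [map_val_zpow, a1, rpow_mul_rpow_zpow ht0 hh0]
    · rw [map_val_zpow, norm_zpow, a2, rpow_mul_rpow_zpow (hψ0 θ) (hψ0 h)]
    · rw [map_val_zpow, norm_zpow, a3, rpow_mul_rpow_zpow (hχ0 θ) (hχ0 h)]
  · rintro v x y x' y' k hk ⟨a1, a2, a3⟩ ⟨c1, c2, c3⟩
    rw [map_val_zpow] at c1 c2 c3
    rw [norm_zpow] at c2 c3
    exact ⟨eq_rpow_mul_rpow_of_zpow_eq ht0 hh0 (by rw [a1]; positivity) hk c1,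
      eq_rpow_mul_rpow_of_zpow_eq (hψ0 θ) (hψ0 h) (norm_nonneg _) hk c2,
      eq_rpow_mul_rpow_of_zpow_eq (hχ0 θ) (hχ0 h) (norm_nonneg _) hk c3⟩
  · simp [hE]
  · simp [hE]
  · rintro v x y ⟨a1, a2, a3⟩ hx hx' hy hxy hy'
    have hφv : 0 < φ v := by rw [a1]; positivity
    have hv0 : ‖evalRoot b (t : ℂ) h0' v‖ = φ v := by
      rw [evalRoot_ofReal h0, Complex.norm_real, Real.norm_of_nonneg hφv.le]
    obtain ⟨h3, h4⟩ := H.charWeight_lt_one hA hx hx' hy hxy hy'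
    have hNv := hprod x y
    rw [← a1, ← a2, ← a3] at hNv
    rw [hφθ, hφh] at a1
    rw [hψθ, hψh] at a2
    rw [hχθ, hχh] at a3
    rw [charWeight, ← a1, ← a2, ← a3, ← hv0] at h3 h4
    obtain ⟨k, hk⟩ := exists_eq_intCast H h0' h1 h2 v h3 h4
    rw [hk, map_intCast, map_intCast, map_intCast] at hNv
    rw [Complex.norm_intCast, sq_abs] at hNv
    have hk5 : k ^ 5 = 1 := by
      have : ((k ^ 5 : ℤ) : ℝ) = ((1 : ℤ) : ℝ) := by
        push_cast
        linear_combination hNv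
      exact_mod_cast this
    have hk1 : k = 1 := by
      have : Odd 5 := by decide
      exact this.strictMono_pow.injective (by simpa using hk5)
    exact Units.ext (by rw [hk, hk1, Int.cast_one, Units.val_one])

lemma thuePoly_neg (b : ℤ) : thuePoly (-b) = thuePoly b := by
  simp [thuePoly, (by decide : Even 4).neg_pow]

lemma thue_iff_of_neg {P : ℤ[X]} {b : ℤ} (hb : b ≤ -1) (hP : P = thuePoly (-b))
    {ξ₁ ξ₂ : (AdjoinRoot P)ˣ} (hξ₁ : (ξ₁ : AdjoinRoot P) = AdjoinRoot.root P)
    (hξ₂ : (ξ₂ : AdjoinRoot P) = (AdjoinRoot.root P) ^ 2 +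
      2 * (b : AdjoinRoot P) * AdjoinRoot.root P + 2 * (b : AdjoinRoot P) ^ 2) (m n : ℤ) :
    m ^ 5 + 4 * b ^ 4 * m * n ^ 4 - n ^ 5 = 1 ↔
      ∃ n₁ n₂ : ℤ, (m : AdjoinRoot P) - (n : AdjoinRoot P) * AdjoinRoot.root P =
        ((ξ₁ ^ n₁ * ξ₂ ^ n₂ : (AdjoinRoot P)ˣ) : AdjoinRoot P) := by
  subst hP
  rw [← norm_form_eq_one_iff (by omega) hξ₁ (by rw [hξ₂]; push_cast; ring),
    (by decide : Even 4).neg_pow]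

/-- Let `b` be a nonzero integer, `R = ℤ[X]/(X^5 + 4*b^4*X - 1)`, `θ` the class of `X`, and
`ξ₁ = θ`, `ξ₂ = θ^2 + 2*b*θ + 2*b^2` the corresponding units of `R`. Then for all integers
`m, n` one has `m^5 + 4*b^4*m*n^4 - n^5 = 1` if and only if `m - n*θ = ξ₁^{n₁}·ξ₂^{n₂}` in `R`
for some integers `n₁, n₂`. -/
theorem quintic_thue_iff_unit_equation (b : ℤ) (hb : b ≠ 0)
    (ξ₁ ξ₂ : (AdjoinRoot (thuePoly b))ˣ)
    (hξ₁ : (ξ₁ : AdjoinRoot (thuePoly b)) = AdjoinRoot.root (thuePoly b))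
    (hξ₂ : (ξ₂ : AdjoinRoot (thuePoly b)) = (AdjoinRoot.root (thuePoly b)) ^ 2 +
      2 * (b : AdjoinRoot (thuePoly b)) * AdjoinRoot.root (thuePoly b) +
      2 * (b : AdjoinRoot (thuePoly b)) ^ 2) :
    ∀ m n : ℤ, m ^ 5 + 4 * b ^ 4 * m * n ^ 4 - n ^ 5 = 1 ↔
      ∃ n₁ n₂ : ℤ,
        (m : AdjoinRoot (thuePoly b)) -
            (n : AdjoinRoot (thuePoly b)) * AdjoinRoot.root (thuePoly b) =
          ((ξ₁ ^ n₁ * ξ₂ ^ n₂ : (AdjoinRoot (thuePoly b))ˣ) : AdjoinRoot (thuePoly b)) := by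
  intro m n
  rcases lt_or_gt_of_ne hb with hb | hb
  · exact thue_iff_of_neg (by omega) (thuePoly_neg b).symm hξ₁ hξ₂ m n
  · have hinv : (((ξ₁ * ξ₂)⁻¹ : (AdjoinRoot (thuePoly b))ˣ) : AdjoinRoot (thuePoly b)) =
        AdjoinRoot.root (thuePoly b) ^ 2 -
          2 * (b : AdjoinRoot (thuePoly b)) * AdjoinRoot.root (thuePoly b) +
          2 * (b : AdjoinRoot (thuePoly b)) ^ 2 := by
      refine Units.inv_eq_of_mul_eq_one_right ?_
      rw [Units.val_mul, hξ₁, hξ₂]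
      linear_combination root_pow_five b
    rw [norm_form_eq_one_iff hb hξ₁ hinv]
    constructor
    · rintro ⟨n₁, n₂, h⟩
      exact ⟨n₁ - n₂, -n₂, by rw [h, inv_zpow', mul_zpow, zpow_sub, zpow_neg, mul_assoc]⟩
    · rintro ⟨n₁, n₂, h⟩
      exact ⟨n₁ - n₂, -n₂, by
        rw [h, inv_zpow', neg_neg, mul_zpow, ← mul_assoc, ← zpow_add, sub_add_cancel]⟩
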